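/- arXiv:2009.12884 — 6 statements merged into one kernel-verified Lean document; each statement's English description precedes it below -/
import Mathlib

section
/- Sewing lemma: Let V be a Banach space, T > 0 and 0 < α < 1 < β. For every Γ ∈ C₂^{α,β}([0,T];V) there exists a unique path 𝒥(Γ) ∈ C^α([0,T];V) with 𝒥(Γ)_0 = 0 such that ‖𝒥(Γ)_t − 𝒥(Γ)_s − Γ_{s,t}‖_V ≤ C₁ ‖δΓ‖_β (t−s)^β for all 0 ≤ s ≤ t ≤ T, where C₁ is a constant depending only on β. Moreover the map Γ ↦ 𝒥(Γ) is linear and there is C₂ = C₂(α,β,T) with ‖𝒥(Γ)‖_α ≤ C₂ ‖Γ‖_{α,β}; and for every t ∈ [0,T] and every sequence of partitions 0 = t_0 < t_1 < … < t_k = t of [0,t] whose mesh tends to 0, the Riemann sums Σ_i Γ_{t_i,t_{i+1}} converge in V to 𝒥(Γ)_t. -/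
open Filter Topology

/-- Pointwise limits of a sequence of linear maps extend to a linear map on the whole space. -/
lemma exists_linearMap_eq_of_tendsto {E F : Type*} [AddCommGroup E] [Module ℝ E]
    [NormedAddCommGroup F] [NormedSpace ℝ F] (f : ℕ → E →ₗ[ℝ] F) :
    ∃ L : E →ₗ[ℝ] F, ∀ x v, Tendsto (fun n => f n x) atTop (𝓝 v) → L x = v := by
  let W : Submodule ℝ E :=
    { carrier := {x | ∃ v, Tendsto (fun n => f n x) atTop (𝓝 v)}
      add_mem' := by
        rintro x y ⟨v, hv⟩ ⟨w, hw⟩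
        exact ⟨v + w, by simpa using hv.add hw⟩
      zero_mem' := ⟨0, by simp⟩
      smul_mem' := by
        rintro c x ⟨v, hv⟩
        exact ⟨c • v, by simpa using hv.const_smul c⟩ }
  have hW : ∀ x : W, ∃ v, Tendsto (fun n => f n (x : E)) atTop (𝓝 v) := fun x => x.2
  choose g hg using hW
  let g' : W →ₗ[ℝ] F :=
    { toFun := g
      map_add' := fun x y => tendsto_nhds_unique (hg (x + y)) (by simpa using (hg x).add (hg y))
      map_smul' := fun c x =>
        tendsto_nhds_unique (hg (c • x)) (by simpa using (hg x).const_smul c) }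
  obtain ⟨L, hL⟩ := g'.exists_extend
  refine ⟨L, fun x v hv => ?_⟩
  have h : L x = g ⟨x, v, hv⟩ := LinearMap.congr_fun hL ⟨x, v, hv⟩
  rw [h]
  exact tendsto_nhds_unique (hg ⟨x, v, hv⟩) hv

/-- A discrete intermediate value property: a value between the endpoints of a finite sequence
lies between two consecutive terms. -/
lemma exists_le_and_le_succ {p : ℕ → ℝ} {m : ℝ} {a b : ℕ} (hab : a < b) (ha : p a ≤ m)
    (hb : m ≤ p b) : ∃ j, a ≤ j ∧ j < b ∧ p j ≤ m ∧ m ≤ p (j + 1) := by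
  induction b, hab using Nat.le_induction with
  | base => exact ⟨a, le_rfl, Nat.lt_succ_self a, ha, hb⟩
  | succ b hab ih =>
    rcases le_total m (p b) with h | h
    · obtain ⟨j, h1, h2, h3⟩ := ih h
      exact ⟨j, h1, by omega, h3⟩
    · exact ⟨b, by omega, by omega, h, hb⟩

/-- If `Γ` is almost additive with exponent `β > 1`, then its sum along any finite partition of
an interval is close to its value on the interval, uniformly in the partition. -/
lemma norm_sum_sub_le_of_almost_additive {V : Type*} [NormedAddCommGroup V] {β C M T : ℝ}
    {Γ : ℝ → ℝ → V} (hβ : 0 < β) (hC : 0 ≤ C) (hCβ : 2 * C * (1 / 2) ^ β + 2 ≤ C) (hM : 0 ≤ M)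
    (h0 : ∀ t : ℝ, 0 ≤ t → t ≤ T → Γ t t = 0)
    (hδ : ∀ s u t : ℝ, 0 ≤ s → s ≤ u → u ≤ t → t ≤ T →
      ‖Γ s t - Γ s u - Γ u t‖ ≤ M * (t - s) ^ β)
    {p : ℕ → ℝ} (hp : Monotone p) (hp0 : ∀ i, 0 ≤ p i) (hpT : ∀ i, p i ≤ T) (n : ℕ) :
    ∀ a, ‖(∑ i ∈ Finset.Ico a (a + n), Γ (p i) (p (i + 1))) - Γ (p a) (p (a + n))‖ ≤
      C * M * (p (a + n) - p a) ^ β := by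
  induction n using Nat.strong_induction_on with
  | _ n ih =>
  intro a
  rcases Nat.eq_zero_or_pos n with rfl | hn
  · simp [h0 _ (hp0 a) (hpT a), Real.zero_rpow hβ.ne']
  have hle : p a ≤ p (a + n) := hp (by omega)
  obtain ⟨j, haj, hjb, hj1, hj2⟩ := exists_le_and_le_succ (p := p)
    (m := (p a + p (a + n)) / 2) (a := a) (b := a + n) (by omega) (by linarith) (by linarith)
  have hpj : p a ≤ p j := hp haj
  have hjj : p j ≤ p (j + 1) := hp (by omega)
  have hjp : p (j + 1) ≤ p (a + n) := hp (by omega)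
  have hl := ih (j - a) (by omega) a
  have hr := ih (a + n - (j + 1)) (by omega) (j + 1)
  rw [show a + (j - a) = j by omega] at hl
  rw [show j + 1 + (a + n - (j + 1)) = a + n by omega] at hr
  have hd1 := hδ (p a) (p j) (p (a + n)) (hp0 _) hpj (hjj.trans hjp) (hpT _)
  have hd2 := hδ (p j) (p (j + 1)) (p (a + n)) (hp0 _) hjj hjp (hpT _)
  set L := p (a + n) - p a with hL
  have hL0 : 0 ≤ L := by linarith
  have half : ∀ x, 0 ≤ x → x ≤ L / 2 → x ^ β ≤ (1 / 2) ^ β * L ^ β := by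
    intro x hx0 hx
    rw [← Real.mul_rpow (by norm_num) hL0]
    exact Real.rpow_le_rpow hx0 (by linarith) hβ.le
  have hCM : 0 ≤ C * M := mul_nonneg hC hM
  have e1 := mul_le_mul_of_nonneg_left (half (p j - p a) (by linarith) (by linarith)) hCM
  have e2 := mul_le_mul_of_nonneg_left
    (half (p (a + n) - p (j + 1)) (by linarith) (by linarith)) hCM
  have e3 : M * (p (a + n) - p j) ^ β ≤ M * L ^ β :=
    mul_le_mul_of_nonneg_left
      (Real.rpow_le_rpow (by linarith) (by linarith) hβ.le) hM
  have e4 := mul_le_mul_of_nonneg_right hCβ (mul_nonneg hM (Real.rpow_nonneg hL0 β))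
  rw [← Finset.sum_Ico_consecutive _ haj hjb.le, Finset.sum_eq_sum_Ico_succ_bot hjb]
  set A := ∑ i ∈ Finset.Ico a j, Γ (p i) (p (i + 1))
  set B := ∑ i ∈ Finset.Ico (j + 1) (a + n), Γ (p i) (p (i + 1))
  have split : A + (Γ (p j) (p (j + 1)) + B) - Γ (p a) (p (a + n)) =
      (A - Γ (p a) (p j)) + (B - Γ (p (j + 1)) (p (a + n)))
      - (Γ (p a) (p (a + n)) - Γ (p a) (p j) - Γ (p j) (p (a + n)))
      - (Γ (p j) (p (a + n)) - Γ (p j) (p (j + 1)) - Γ (p (j + 1)) (p (a + n))) := by abel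
  rw [split]
  refine (norm_sub_le _ _).trans ?_
  have t1 := norm_sub_le ((A - Γ (p a) (p j)) + (B - Γ (p (j + 1)) (p (a + n))))
    (Γ (p a) (p (a + n)) - Γ (p a) (p j) - Γ (p j) (p (a + n)))
  have t2 := norm_add_le (A - Γ (p a) (p j)) (B - Γ (p (j + 1)) (p (a + n)))
  linarith

/-- A path whose increments agree with `Γ` up to an error of order `β > 1` is the limit of the
Riemann sums of `Γ`. -/
lemma tendsto_sum_of_norm_sub_le {V : Type*} [NormedAddCommGroup V] {β K T t : ℝ}
    {Γ : ℝ → ℝ → V} {J : ℝ → V} (hβ : 1 < β) (hK : 0 ≤ K) (hJ0 : J 0 = 0)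
    (hJ : ∀ s t : ℝ, 0 ≤ s → s ≤ t → t ≤ T → ‖J t - J s - Γ s t‖ ≤ K * (t - s) ^ β)
    (htT : t ≤ T) {k : ℕ → ℕ} {p : ℕ → ℕ → ℝ}
    (hp0 : ∀ n, p n 0 = 0) (hpk : ∀ n, p n (k n) = t)
    (hp : ∀ n i, i < k n → p n i < p n (i + 1))
    (hmesh : ∀ ε : ℝ, 0 < ε → ∃ N : ℕ, ∀ n, N ≤ n → ∀ i, i < k n → p n (i + 1) - p n i < ε) :
    Tendsto (fun n => ∑ i ∈ Finset.range (k n), Γ (p n i) (p n (i + 1))) atTop (𝓝 (J t)) := by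
  have hmono : ∀ n j, j ≤ k n → ∀ i, i ≤ j → p n i ≤ p n j := by
    intro n j hj i hij
    induction j, hij using Nat.le_induction with
    | base => exact le_rfl
    | succ j hij ih => exact (ih (by omega)).trans (hp n j (by omega)).le
  rw [Metric.tendsto_atTop]
  intro η hη
  have hlim : Tendsto (fun ε : ℝ => K * ε ^ (β - 1) * t) (𝓝[>] 0) (𝓝 0) := by
    have h1 : ContinuousAt (fun ε : ℝ => K * ε ^ (β - 1) * t) 0 := by
      have := Real.continuousAt_rpow_const 0 (β - 1) (Or.inr (by linarith))
      fun_prop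
    have h2 := h1.tendsto
    rw [Real.zero_rpow (by linarith), mul_zero, zero_mul] at h2
    exact h2.mono_left nhdsWithin_le_nhds
  obtain ⟨ε, hεη, hε⟩ := ((hlim.eventually (gt_mem_nhds hη)).and self_mem_nhdsWithin).exists
  have hε : 0 < ε := hε
  obtain ⟨N, hN⟩ := hmesh ε hε
  refine ⟨N, fun n hn => lt_of_le_of_lt ?_ hεη⟩
  have hJt : J t = ∑ i ∈ Finset.range (k n), (J (p n (i + 1)) - J (p n i)) := by
    rw [Finset.sum_range_sub (fun i => J (p n i)), hpk, hp0, hJ0, sub_zero]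
  rw [dist_comm, dist_eq_norm, hJt, ← Finset.sum_sub_distrib]
  calc _ ≤ ∑ i ∈ Finset.range (k n), K * ε ^ (β - 1) * (p n (i + 1) - p n i) := by
        refine norm_sum_le_of_le _ fun i hi => ?_
        rw [Finset.mem_range] at hi
        have hpos : 0 < p n (i + 1) - p n i := sub_pos.2 (hp n i hi)
        have h0i : 0 ≤ p n i := hp0 n ▸ hmono n i hi.le 0 (Nat.zero_le i)
        have hiT : p n (i + 1) ≤ T := (hpk n ▸ hmono n (k n) le_rfl (i + 1) hi).trans htT
        refine (hJ _ _ h0i (hp n i hi).le hiT).trans ?_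
        rw [mul_assoc]
        refine mul_le_mul_of_nonneg_left ?_ hK
        calc (p n (i + 1) - p n i) ^ β
            = (p n (i + 1) - p n i) ^ (β - 1) * (p n (i + 1) - p n i) := by
              rw [← Real.rpow_add_one hpos.ne', sub_add_cancel]
          _ ≤ _ := mul_le_mul_of_nonneg_right
              (Real.rpow_le_rpow hpos.le (hN n hn i hi).le (by linarith)) hpos.le
    _ = K * ε ^ (β - 1) * t := by
        rw [← Finset.mul_sum, Finset.sum_range_sub (p n), hpk, hp0, sub_zero]

/-- The sum of `2 ^ n` terms of size `M * (T / 2 ^ n) ^ β` as a geometric sequence. -/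
lemma two_pow_mul_div_two_pow_rpow {T : ℝ} (hT : 0 ≤ T) (β M : ℝ) (n : ℕ) :
    2 ^ n * (M * (T / 2 ^ n) ^ β) = M * T ^ β * ((2 : ℝ) ^ (1 - β)) ^ n := by
  rw [Real.div_rpow hT (by positivity), ← Real.rpow_natCast, ← Real.rpow_natCast,
    ← Real.rpow_mul (by norm_num), ← Real.rpow_mul (by norm_num),
    show (1 - β) * (n : ℝ) = n - n * β by ring, Real.rpow_sub (by norm_num)]
  ring

/-- Splitting an increment of `Γ`, stopped at `t`, at an earlier time `s`. -/
lemma norm_sub_clamp_le {V : Type*} [NormedAddCommGroup V] {β M T : ℝ} {Γ : ℝ → ℝ → V}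
    (hM : 0 ≤ M) (hβ : 0 < β)
    (h0 : ∀ t : ℝ, 0 ≤ t → t ≤ T → Γ t t = 0)
    (hδ : ∀ s u t : ℝ, 0 ≤ s → s ≤ u → u ≤ t → t ≤ T →
      ‖Γ s t - Γ s u - Γ u t‖ ≤ M * (t - s) ^ β)
    {s t a b : ℝ} (hs0 : 0 ≤ s) (hst : s ≤ t) (htT : t ≤ T) (ha : 0 ≤ a) (hab : a ≤ b) :
    ‖Γ (min a t) (min b t) - Γ (min a s) (min b s) -
      Γ (min (max a s) t) (min (max b s) t)‖ ≤ M * (b - a) ^ β := by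
  have hnn : 0 ≤ M * (b - a) ^ β := mul_nonneg hM (Real.rpow_nonneg (by linarith) β)
  rcases le_total b s with hb | hb
  · rw [min_eq_left (hab.trans (hb.trans hst)), min_eq_left (hb.trans hst),
      min_eq_left (hab.trans hb), min_eq_left hb, max_eq_right (hab.trans hb),
      max_eq_right hb, min_eq_left hst, h0 s hs0 (hst.trans htT)]
    simpa using hnn
  rcases le_total s a with h | h
  · rw [min_eq_right h, min_eq_right hb, max_eq_left h, max_eq_left hb,
      h0 s hs0 (hst.trans htT)]
    simpa using hnn
  · rw [min_eq_left (h.trans hst), min_eq_left h, min_eq_right hb, max_eq_right h,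
      max_eq_left hb, min_eq_left hst]
    have hsb : s ≤ min b t := le_min hb hst
    refine (hδ a s (min b t) ha h hsb ((min_le_right _ _).trans htT)).trans ?_
    exact mul_le_mul_of_nonneg_left (Real.rpow_le_rpow (by linarith)
      (sub_le_sub_right (min_le_left b t) a) hβ.le) hM

lemma sum_range_two_mul {M : Type*} [AddCommMonoid M] (f : ℕ → M) (n : ℕ) :
    ∑ i ∈ Finset.range (2 * n), f i = ∑ i ∈ Finset.range n, (f (2 * i) + f (2 * i + 1)) := by
  induction n with
  | zero => simp
  | succ n ih => rw [mul_add, mul_one, Finset.sum_range_succ, Finset.sum_range_succ,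
      Finset.sum_range_succ, ih, add_assoc]

/-- The Riemann sum of `Γ` along the dyadic grid of `[0, T]` of level `n`, stopped at `t`. -/
noncomputable def dyadicSum {V : Type*} [NormedAddCommGroup V] [NormedSpace ℝ V]
    (T t : ℝ) (n : ℕ) : (ℝ → ℝ → V) →ₗ[ℝ] V :=
  ∑ i ∈ Finset.range (2 ^ n),
    LinearMap.proj (R := ℝ) (φ := fun _ : ℝ => V) (min (((i + 1 : ℕ) : ℝ) * (T / 2 ^ n)) t) ∘ₗ
      LinearMap.proj (R := ℝ) (φ := fun _ : ℝ => ℝ → V) (min ((i : ℝ) * (T / 2 ^ n)) t)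

section Dyadic

variable {V : Type*} [NormedAddCommGroup V] [NormedSpace ℝ V]

lemma dyadicSum_apply (T t : ℝ) (n : ℕ) (Γ : ℝ → ℝ → V) :
    dyadicSum T t n Γ = ∑ i ∈ Finset.range (2 ^ n),
      Γ (min ((i : ℝ) * (T / 2 ^ n)) t) (min (((i + 1 : ℕ) : ℝ) * (T / 2 ^ n)) t) := by
  simp [dyadicSum]

variable {β M T : ℝ} {Γ : ℝ → ℝ → V}

/-- Consecutive dyadic sums differ by a term of a geometric sequence. -/
lemma dist_dyadicSum_succ_le (hβ : 1 < β) (hT : 0 < T) (hM : 0 ≤ M)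
    (hδ : ∀ s u t : ℝ, 0 ≤ s → s ≤ u → u ≤ t → t ≤ T →
      ‖Γ s t - Γ s u - Γ u t‖ ≤ M * (t - s) ^ β)
    {t : ℝ} (ht0 : 0 ≤ t) (htT : t ≤ T) (n : ℕ) :
    dist (dyadicSum T t n Γ) (dyadicSum T t (n + 1) Γ) ≤
      M * T ^ β * ((2 : ℝ) ^ (1 - β)) ^ n := by
  rw [← two_pow_mul_div_two_pow_rpow hT.le, dist_eq_norm, dyadicSum_apply, dyadicSum_apply,
    pow_succ' 2 n, sum_range_two_mul, ← Finset.sum_sub_distrib]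
  have hh : 0 < T / 2 ^ n := by positivity
  have hhalf : T / 2 ^ (n + 1) = T / 2 ^ n / 2 := by rw [pow_succ]; field_simp
  have key : ∀ i ∈ Finset.range (2 ^ n),
      ‖Γ (min ((i : ℝ) * (T / 2 ^ n)) t) (min (((i + 1 : ℕ) : ℝ) * (T / 2 ^ n)) t) -
        (Γ (min (((2 * i : ℕ) : ℝ) * (T / 2 ^ (n + 1))) t)
            (min (((2 * i + 1 : ℕ) : ℝ) * (T / 2 ^ (n + 1))) t) +
          Γ (min (((2 * i + 1 : ℕ) : ℝ) * (T / 2 ^ (n + 1))) t)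
            (min (((2 * i + 1 + 1 : ℕ) : ℝ) * (T / 2 ^ (n + 1))) t))‖ ≤
      M * (T / 2 ^ n) ^ β := by
    intro i _
    have hi : (0 : ℝ) ≤ i := Nat.cast_nonneg i
    rw [hhalf, show ((2 * i : ℕ) : ℝ) * (T / 2 ^ n / 2) = i * (T / 2 ^ n) by push_cast; ring,
      show ((2 * i + 1 + 1 : ℕ) : ℝ) * (T / 2 ^ n / 2) = ((i + 1 : ℕ) : ℝ) * (T / 2 ^ n) by
        push_cast; ring, ← sub_sub]
    set h := T / 2 ^ n
    have l1 : (i : ℝ) * h ≤ ((2 * i + 1 : ℕ) : ℝ) * (h / 2) := by push_cast; nlinarith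
    have l2 : ((2 * i + 1 : ℕ) : ℝ) * (h / 2) ≤ ((i + 1 : ℕ) : ℝ) * h := by push_cast; nlinarith
    refine (hδ _ _ _ (le_min (by positivity) ht0) (min_le_min_right t l1)
      (min_le_min_right t l2) ((min_le_right _ _).trans htT)).trans ?_
    refine mul_le_mul_of_nonneg_left (Real.rpow_le_rpow
      (sub_nonneg.2 (min_le_min_right t (l1.trans l2))) ?_ (by linarith)) hM
    have : ((i + 1 : ℕ) : ℝ) * h = i * h + h := by push_cast; ring
    rw [this]
    rcases min_cases ((i : ℝ) * h + h) t with ⟨h1, h2⟩ | ⟨h1, h2⟩ <;>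
      rcases min_cases ((i : ℝ) * h) t with ⟨h3, h4⟩ | ⟨h3, h4⟩ <;> linarith
  refine (norm_sum_le_of_le _ key).trans (le_of_eq ?_)
  simp

/-- Limits of dyadic sums satisfy the sewing bound. -/
lemma norm_limit_dyadicSum_sub_le {C : ℝ} (hβ : 1 < β) (hT : 0 < T) (hC : 0 ≤ C)
    (hCβ : 2 * C * (1 / 2) ^ β + 2 ≤ C) (hM : 0 ≤ M)
    (h0 : ∀ t : ℝ, 0 ≤ t → t ≤ T → Γ t t = 0)
    (hδ : ∀ s u t : ℝ, 0 ≤ s → s ≤ u → u ≤ t → t ≤ T →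
      ‖Γ s t - Γ s u - Γ u t‖ ≤ M * (t - s) ^ β)
    {s t : ℝ} (hs0 : 0 ≤ s) (hst : s ≤ t) (htT : t ≤ T) {x y : V}
    (hx : Tendsto (fun n => dyadicSum T s n Γ) atTop (𝓝 x))
    (hy : Tendsto (fun n => dyadicSum T t n Γ) atTop (𝓝 y)) :
    ‖y - x - Γ s t‖ ≤ C * M * (t - s) ^ β := by
  have hr : (2 : ℝ) ^ (1 - β) < 1 := Real.rpow_lt_one_of_one_lt_of_neg (by norm_num) (by linarith)
  have hlim : Tendsto (fun n : ℕ => M * T ^ β * ((2 : ℝ) ^ (1 - β)) ^ n + C * M * (t - s) ^ β)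
      atTop (𝓝 (C * M * (t - s) ^ β)) := by
    have := ((tendsto_pow_atTop_nhds_zero_of_lt_one (by positivity) hr).const_mul
      (M * T ^ β)).add_const (C * M * (t - s) ^ β)
    simpa using this
  refine le_of_tendsto_of_tendsto' ((hy.sub hx).sub_const (Γ s t)).norm hlim fun n => ?_
  have hh : 0 < T / 2 ^ n := by positivity
  let q : ℕ → ℝ := fun i => min (max ((i : ℝ) * (T / 2 ^ n)) s) t
  have hq : Monotone q := fun i j hij => by
    refine min_le_min_right t (max_le_max_right s (mul_le_mul_of_nonneg_right ?_ hh.le))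
    exact_mod_cast hij
  have hsum := norm_sum_sub_le_of_almost_additive (by linarith) hC hCβ hM h0 hδ hq
    (fun i => le_min (hs0.trans (le_max_right _ _)) (hs0.trans hst))
    (fun i => (min_le_right _ _).trans htT) (2 ^ n) 0
  have hq0 : q 0 = s := by simp [q, hs0, hst]
  have hqn : q (2 ^ n) = t := by
    have : ((2 ^ n : ℕ) : ℝ) * (T / 2 ^ n) = T := by push_cast; field_simp
    simp only [q, this]
    exact min_eq_right (htT.trans (le_max_left _ _))
  rw [zero_add, hq0, hqn, ← Finset.range_eq_Ico] at hsum
  have hdiff : ‖dyadicSum T t n Γ - dyadicSum T s n Γ -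
      ∑ i ∈ Finset.range (2 ^ n), Γ (q i) (q (i + 1))‖ ≤ M * T ^ β * ((2 : ℝ) ^ (1 - β)) ^ n := by
    rw [dyadicSum_apply, dyadicSum_apply, ← Finset.sum_sub_distrib, ← Finset.sum_sub_distrib,
      ← two_pow_mul_div_two_pow_rpow hT.le]
    have key : ∀ i ∈ Finset.range (2 ^ n), ‖_‖ ≤ M * (T / 2 ^ n) ^ β := fun i _ => by
      have hi : ((i + 1 : ℕ) : ℝ) * (T / 2 ^ n) - i * (T / 2 ^ n) = T / 2 ^ n := by
        push_cast; ring
      have := norm_sub_clamp_le hM (by linarith) h0 hδ hs0 hst htT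
        (a := i * (T / 2 ^ n)) (b := ((i + 1 : ℕ) : ℝ) * (T / 2 ^ n))
        (by positivity) (by linarith)
      rwa [hi] at this
    refine (norm_sum_le_of_le _ key).trans (le_of_eq ?_)
    simp
  calc _ = ‖(dyadicSum T t n Γ - dyadicSum T s n Γ -
        ∑ i ∈ Finset.range (2 ^ n), Γ (q i) (q (i + 1))) +
        (∑ i ∈ Finset.range (2 ^ n), Γ (q i) (q (i + 1)) - Γ s t)‖ := by congr 1; abel
    _ ≤ _ := (norm_add_le _ _).trans (add_le_add hdiff hsum)

end Dyadic


/-- **Sewing lemma.**  Let `V` be a Banach space, `T > 0` and `0 < α < 1 < β`.  For every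
`Γ ∈ C₂^{α,β}([0,T];V)` (encoded by the bound constants `MΓ`, `Mδ`) there is a unique path
`𝒥 Γ ∈ C^α([0,T];V)` with `𝒥 Γ 0 = 0` and
`‖𝒥 Γ t - 𝒥 Γ s - Γ s t‖ ≤ C₁ ‖δΓ‖_β (t-s)^β`; the map `Γ ↦ 𝒥 Γ` is linear, bounded with
constant `C₂ = C₂(α,β,T)`, and `𝒥 Γ t` is the limit of the Riemann sums along any sequence of
partitions of `[0,t]` with vanishing mesh. -/
theorem sewing_lemma
    {V : Type*} [NormedAddCommGroup V] [NormedSpace ℝ V] [CompleteSpace V]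
    (α β : ℝ) (hα0 : 0 < α) (hα1 : α < 1) (hβ : 1 < β) :
    ∃ C₁ : ℝ, 0 ≤ C₁ ∧
      ∀ T : ℝ, 0 < T →
        ∃ C₂ : ℝ, 0 ≤ C₂ ∧
          ∃ 𝒥 : (ℝ → ℝ → V) →ₗ[ℝ] (ℝ → V),
            ∀ (Γ : ℝ → ℝ → V) (MΓ Mδ : ℝ),
              (∀ t : ℝ, 0 ≤ t → t ≤ T → Γ t t = 0) →
              (∀ s t : ℝ, 0 ≤ s → s ≤ t → t ≤ T → ‖Γ s t‖ ≤ MΓ * (t - s) ^ α) →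
              (∀ s u t : ℝ, 0 ≤ s → s ≤ u → u ≤ t → t ≤ T →
                ‖Γ s t - Γ s u - Γ u t‖ ≤ Mδ * (t - s) ^ β) →
              𝒥 Γ 0 = 0 ∧
              (∀ s t : ℝ, 0 ≤ s → s ≤ t → t ≤ T →
                ‖𝒥 Γ t - 𝒥 Γ s - Γ s t‖ ≤ C₁ * Mδ * (t - s) ^ β) ∧
              (∀ s t : ℝ, 0 ≤ s → s ≤ t → t ≤ T →
                ‖𝒥 Γ t - 𝒥 Γ s‖ ≤ C₂ * (MΓ + Mδ) * (t - s) ^ α) ∧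
              (∀ t : ℝ, 0 ≤ t → t ≤ T → ‖𝒥 Γ t‖ ≤ C₂ * (MΓ + Mδ)) ∧
              (∀ J : ℝ → V, J 0 = 0 →
                (∀ s t : ℝ, 0 ≤ s → s ≤ t → t ≤ T →
                  ‖J t - J s - Γ s t‖ ≤ C₁ * Mδ * (t - s) ^ β) →
                ∀ t : ℝ, 0 ≤ t → t ≤ T → J t = 𝒥 Γ t) ∧
              (∀ t : ℝ, 0 ≤ t → t ≤ T →
                ∀ (k : ℕ → ℕ) (p : ℕ → ℕ → ℝ),
                  (∀ n, p n 0 = 0) → (∀ n, p n (k n) = t) →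
                  (∀ n i, i < k n → p n i < p n (i + 1)) →
                  (∀ ε : ℝ, 0 < ε → ∃ N : ℕ, ∀ n, N ≤ n → ∀ i, i < k n →
                    p n (i + 1) - p n i < ε) →
                  Filter.Tendsto
                    (fun n => ∑ i ∈ Finset.range (k n), Γ (p n i) (p n (i + 1)))
                    Filter.atTop (nhds (𝒥 Γ t))) := by
  set r : ℝ := 2 * (1 / 2) ^ β with hr_def
  have hr : r < 1 := by
    have h : ((1 : ℝ) / 2) ^ β < (1 / 2) ^ (1 : ℝ) :=
      Real.rpow_lt_rpow_of_exponent_gt (by norm_num) (by norm_num) hβ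
    rw [Real.rpow_one] at h
    linarith
  have hr' : 0 < 1 - r := sub_pos.2 hr
  set C : ℝ := 2 / (1 - r) with hC_def
  have hC : 0 ≤ C := by positivity
  have hCβ : 2 * C * (1 / 2) ^ β + 2 ≤ C := by
    have h : C * (1 - r) = 2 := by rw [hC_def]; field_simp
    rw [hr_def] at h
    linarith
  refine ⟨C, hC, fun T hT => ?_⟩
  set D : ℝ := 1 + C * T ^ (β - α) with hD_def
  have hD1 : 1 ≤ D := le_add_of_nonneg_right (by positivity)
  have hDC : C * T ^ (β - α) ≤ D := by linarith
  have hTα : 0 ≤ T ^ α := by positivity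
  refine ⟨D * (1 + T ^ α), by positivity, ?_⟩
  choose L hL using fun t : ℝ => exists_linearMap_eq_of_tendsto (dyadicSum (V := V) T t)
  refine ⟨LinearMap.pi L, fun Γ MΓ Mδ h0 hΓ hδ => ?_⟩
  simp only [LinearMap.pi_apply]
  have hMΓ : 0 ≤ MΓ :=
    nonneg_of_mul_nonneg_left ((norm_nonneg _).trans (hΓ 0 T le_rfl hT.le le_rfl))
      (Real.rpow_pos_of_pos (by linarith) α)
  have hMδ : 0 ≤ Mδ :=
    nonneg_of_mul_nonneg_left ((norm_nonneg _).trans (hδ 0 0 T le_rfl le_rfl hT.le le_rfl))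
      (Real.rpow_pos_of_pos (by linarith) β)
  have hlim : ∀ t, 0 ≤ t → t ≤ T →
      Tendsto (fun n => dyadicSum T t n Γ) atTop (𝓝 (L t Γ)) := by
    intro t ht0 htT
    obtain ⟨v, hv⟩ := cauchySeq_tendsto_of_complete
      (cauchySeq_of_le_geometric ((2 : ℝ) ^ (1 - β)) (Mδ * T ^ β)
        (Real.rpow_lt_one_of_one_lt_of_neg (by norm_num) (by linarith))
        (dist_dyadicSum_succ_le hβ hT hMδ hδ ht0 htT))
    rwa [hL t Γ v hv]
  have hJ0 : L 0 Γ = 0 := by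
    refine hL 0 Γ 0 (tendsto_const_nhds.congr fun n => ?_)
    rw [dyadicSum_apply, Finset.sum_eq_zero]
    intro i _
    rw [min_eq_right (by positivity), min_eq_right (by positivity), h0 0 le_rfl hT.le]
  have hJ : ∀ s t : ℝ, 0 ≤ s → s ≤ t → t ≤ T →
      ‖L t Γ - L s Γ - Γ s t‖ ≤ C * Mδ * (t - s) ^ β := fun s t hs hst ht =>
    norm_limit_dyadicSum_sub_le hβ hT hC hCβ hMδ h0 hδ hs hst ht
      (hlim s hs (hst.trans ht)) (hlim t (hs.trans hst) ht)
  have hHolder : ∀ s t : ℝ, 0 ≤ s → s ≤ t → t ≤ T →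
      ‖L t Γ - L s Γ‖ ≤ D * (MΓ + Mδ) * (t - s) ^ α := by
    intro s t hs hst ht
    have hts : 0 ≤ t - s := sub_nonneg.2 hst
    have hβα : (t - s) ^ β ≤ T ^ (β - α) * (t - s) ^ α := by
      calc (t - s) ^ β = (t - s) ^ (β - α) * (t - s) ^ α := by
            rw [← Real.rpow_add_of_nonneg hts (by linarith) hα0.le, sub_add_cancel]
        _ ≤ _ := mul_le_mul_of_nonneg_right
            (Real.rpow_le_rpow hts (by linarith) (by linarith)) (Real.rpow_nonneg hts α)
    calc ‖L t Γ - L s Γ‖ = ‖(L t Γ - L s Γ - Γ s t) + Γ s t‖ := by rw [sub_add_cancel]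
      _ ≤ C * Mδ * (t - s) ^ β + MΓ * (t - s) ^ α :=
          (norm_add_le _ _).trans (add_le_add (hJ s t hs hst ht) (hΓ s t hs hst ht))
      _ ≤ C * Mδ * (T ^ (β - α) * (t - s) ^ α) + MΓ * (t - s) ^ α := by gcongr
      _ = (C * T ^ (β - α) * Mδ + 1 * MΓ) * (t - s) ^ α := by ring
      _ ≤ (D * Mδ + D * MΓ) * (t - s) ^ α := by gcongr
      _ = D * (MΓ + Mδ) * (t - s) ^ α := by ring
  have hDM : 0 ≤ D * (MΓ + Mδ) := by positivity
  refine ⟨hJ0, hJ, fun s t hs hst ht => (hHolder s t hs hst ht).trans ?_, fun t ht0 htT => ?_,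
    fun J hJ0' hJ' t ht0 htT => ?_, fun t ht0 htT k p hp0 hpk hp hmesh =>
      tendsto_sum_of_norm_sub_le (J := fun t => L t Γ) hβ (mul_nonneg hC hMδ) hJ0 hJ htT
        hp0 hpk hp hmesh⟩
  · refine mul_le_mul_of_nonneg_right ?_ (Real.rpow_nonneg (by linarith) α)
    nlinarith [mul_nonneg hDM hTα]
  · have h := hHolder 0 t le_rfl ht0 htT
    rw [hJ0, sub_zero, sub_zero] at h
    have h' := mul_le_mul_of_nonneg_left (Real.rpow_le_rpow ht0 htT hα0.le) hDM
    linarith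
  · rcases ht0.eq_or_lt with rfl | ht
    · rw [hJ0, hJ0']
    have hp0 : ∀ n : ℕ, ((0 : ℕ) : ℝ) * (t / ((n : ℝ) + 1)) = 0 := by simp
    have hpk : ∀ n : ℕ, ((n + 1 : ℕ) : ℝ) * (t / ((n : ℝ) + 1)) = t := fun n => by
      push_cast; field_simp
    have hstep : ∀ n i : ℕ,
        ((i + 1 : ℕ) : ℝ) * (t / ((n : ℝ) + 1)) - i * (t / ((n : ℝ) + 1)) = t / ((n : ℝ) + 1) :=
      fun n i => by push_cast; ring
    have hp : ∀ n i : ℕ, i < n + 1 →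
        (i : ℝ) * (t / ((n : ℝ) + 1)) < ((i + 1 : ℕ) : ℝ) * (t / ((n : ℝ) + 1)) := fun n i _ => by
      have : 0 < t / ((n : ℝ) + 1) := by positivity
      linarith [hstep n i]
    have hmesh : ∀ ε : ℝ, 0 < ε → ∃ N : ℕ, ∀ n, N ≤ n → ∀ i : ℕ, i < n + 1 →
        ((i + 1 : ℕ) : ℝ) * (t / ((n : ℝ) + 1)) - i * (t / ((n : ℝ) + 1)) < ε := by
      intro ε hε
      have h : Tendsto (fun n : ℕ => t / ((n : ℝ) + 1)) atTop (𝓝 0) := by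
        simpa [div_eq_mul_inv] using tendsto_one_div_add_atTop_nhds_zero_nat.const_mul t
      obtain ⟨N, hN⟩ := eventually_atTop.1 (h.eventually (gt_mem_nhds hε))
      exact ⟨N, fun n hn i _ => by rw [hstep]; exact hN n hn⟩
    exact tendsto_nhds_unique
      (tendsto_sum_of_norm_sub_le hβ (mul_nonneg hC hMδ) hJ0' hJ' htT
        (k := fun n => n + 1) (p := fun n i => (i : ℝ) * (t / ((n : ℝ) + 1))) hp0 hpk hp hmesh)
      (tendsto_sum_of_norm_sub_le (J := fun t => L t Γ) hβ (mul_nonneg hC hMδ) hJ0 hJ htT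
        (k := fun n => n + 1) (p := fun n i => (i : ℝ) * (t / ((n : ℝ) + 1))) hp0 hpk hp hmesh)
end

section
/- Hölder continuity of the nonlinear Young integral in the integrand path: Let α, β, γ ∈ (0,1) with α + βγ > 1 and let δ ∈ (0,1) satisfy δ < (α + βγ − 1)/γ. There exists a constant C₃ = C₃(α,β,γ,δ,T) such that for every A : [0,T] × V → W with A(0,·) = 0 and ‖A‖_{α,β,R} < ∞ for all R ≥ 0, all x, y ∈ C^γ([0,T];V), and every R ≥ ‖x‖_∞ ∨ ‖y‖_∞, the nonlinear Young integrals I^x = ∫_0^· A(du, x_u) and I^y = ∫_0^· A(du, y_u) satisfy ‖I^x − I^y‖_α ≤ C₃ ‖A‖_{α,β,R} (1 + ‖x‖_γ + ‖y‖_γ) (sup_{t∈[0,T]} ‖x_t − y_t‖_V)^δ. -/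
/-- The supremum norm of a path on `[0,T]`. -/
noncomputable def supNormOn {W : Type*} [NormedAddCommGroup W] (T : ℝ) (f : ℝ → W) : ℝ :=
  sSup {r : ℝ | ∃ t : ℝ, 0 ≤ t ∧ t ≤ T ∧ r = ‖f t‖}

/-- The `α`-Hölder seminorm of a path on `[0,T]`. -/
noncomputable def holderSemiOn {W : Type*} [NormedAddCommGroup W] (α T : ℝ) (f : ℝ → W) : ℝ :=
  sSup {r : ℝ | ∃ s t : ℝ, 0 ≤ s ∧ s < t ∧ t ≤ T ∧ r = ‖f t - f s‖ / (t - s) ^ α}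

/-- A two-parameter map of order `μ > 1` is controlled by its defect of additivity. -/
theorem norm_le_of_additivity_defect {W : Type*} [NormedAddCommGroup W] {T μ B L : ℝ}
    (hμ : 1 < μ) (F : ℝ → ℝ → W)
    (hF : ∀ s t : ℝ, 0 ≤ s → s ≤ t → t ≤ T → ‖F s t‖ ≤ L * (t - s) ^ μ)
    (hB : ∀ s u t : ℝ, 0 ≤ s → s ≤ u → u ≤ t → t ≤ T →
      ‖F s t - F s u - F u t‖ ≤ B * (t - s) ^ μ)
    {s t : ℝ} (hs : 0 ≤ s) (hst : s ≤ t) (ht : t ≤ T) :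
    ‖F s t‖ ≤ B / (1 - 2 ^ (1 - μ)) * (t - s) ^ μ := by
  set q : ℝ := 2 ^ (1 - μ) with hq
  have hq0 : 0 < q := by positivity
  have hq1 : q < 1 := Real.rpow_lt_one_of_one_lt_of_neg (by norm_num) (by linarith)
  have half_rpow (h : ℝ) (hh : 0 ≤ h) : 2 * (h / 2) ^ μ = q * h ^ μ := by
    rw [Real.div_rpow hh (by norm_num), hq, Real.rpow_sub (by norm_num), Real.rpow_one]
    ring
  have iterated_bound (n : ℕ) : ∀ s t : ℝ, 0 ≤ s → s ≤ t → t ≤ T →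
      ‖F s t‖ ≤ (q ^ n * (L - B / (1 - q)) + B / (1 - q)) * (t - s) ^ μ := by
    induction n with
    | zero => intro s t hs hst ht; simpa using hF s t hs hst ht
    | succ n ih =>
      intro s t hs hst ht
      set c := q ^ n * (L - B / (1 - q)) + B / (1 - q) with hc
      have h1 := ih s ((s + t) / 2) hs (by linarith) (by linarith)
      have h2 := ih ((s + t) / 2) t (by linarith) (by linarith) ht
      have h3 := hB s ((s + t) / 2) t hs (by linarith) (by linarith) ht
      rw [show (s + t) / 2 - s = (t - s) / 2 by ring] at h1
      rw [show t - (s + t) / 2 = (t - s) / 2 by ring] at h2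
      have hsplit : ‖F s t‖ ≤ ‖F s t - F s ((s + t) / 2) - F ((s + t) / 2) t‖ +
          ‖F s ((s + t) / 2)‖ + ‖F ((s + t) / 2) t‖ := by
        refine le_trans (le_of_eq ?_) (norm_add₃_le (a :=
          F s t - F s ((s + t) / 2) - F ((s + t) / 2) t))
        congr 1
        abel
      calc ‖F s t‖ ≤ B * (t - s) ^ μ + c * (2 * ((t - s) / 2) ^ μ) := by linarith
        _ = (q * c + B) * (t - s) ^ μ := by
          rw [half_rpow _ (by linarith)]
          ring
        _ = _ := by
          rw [hc]
          have : 1 - q ≠ 0 := by linarith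
          field_simp
          ring
  have hlim : Filter.Tendsto
      (fun n : ℕ => (q ^ n * (L - B / (1 - q)) + B / (1 - q)) * (t - s) ^ μ)
      Filter.atTop (nhds ((0 * (L - B / (1 - q)) + B / (1 - q)) * (t - s) ^ μ)) :=
    (((tendsto_pow_atTop_nhds_zero_of_lt_one hq0.le hq1).mul_const _).add_const _).mul_const _
  simpa using ge_of_tendsto' hlim fun n => iterated_bound n s t hs hst ht

/-- Interpolation between the two bounds `m ≤ D` and `m ≤ N * h`. -/
theorem rpow_le_of_le_of_le_mul {m D N h β δ : ℝ} (hm : 0 ≤ m) (hmD : m ≤ D)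
    (hN : 1 ≤ N) (hh : 0 ≤ h) (hmN : m ≤ N * h) (hδ : 0 < δ) (hδβ : δ < β) (hβδ : β ≤ 1 + δ) :
    m ^ β ≤ D ^ δ * (N * h ^ (β - δ)) := by
  have hD : 0 ≤ D := hm.trans hmD
  calc m ^ β = m ^ δ * m ^ (β - δ) := by
        rw [← Real.rpow_add_of_nonneg hm hδ.le (by linarith)]
        congr 1
        ring
    _ ≤ D ^ δ * (N * h) ^ (β - δ) := by gcongr
    _ = D ^ δ * (N ^ (β - δ) * h ^ (β - δ)) := by rw [Real.mul_rpow (by linarith) hh]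
    _ ≤ D ^ δ * (N * h ^ (β - δ)) := by
        gcongr
        simpa using Real.rpow_le_rpow_of_exponent_le hN (show β - δ ≤ 1 by linarith)

/-- The norm of a path started at `0` is controlled by its Hölder increments. -/
theorem supNormOn_add_holderSemiOn_le {W : Type*} [NormedAddCommGroup W] {α T C : ℝ}
    (hα : 0 < α) (hT : 0 ≤ T) (hC : 0 ≤ C) {f : ℝ → W} (hf0 : f 0 = 0)
    (hf : ∀ s t : ℝ, 0 ≤ s → s ≤ t → t ≤ T → ‖f t - f s‖ ≤ C * (t - s) ^ α) :
    supNormOn T f + holderSemiOn α T f ≤ (T ^ α + 1) * C := by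
  have hsup : supNormOn T f ≤ C * T ^ α := by
    refine Real.sSup_le ?_ (by positivity)
    rintro r ⟨t, h0, hT', rfl⟩
    have h := hf 0 t le_rfl h0 hT'
    rw [hf0, sub_zero, sub_zero] at h
    exact h.trans (by gcongr)
  have hsemi : holderSemiOn α T f ≤ C := by
    refine Real.sSup_le ?_ hC
    rintro r ⟨s, t, h0, hst, hT', rfl⟩
    have hpos : 0 < t - s := sub_pos.2 hst
    rw [div_le_iff₀ (by positivity)]
    exact hf s t h0 hst.le hT'
  linarith

/-- **Hölder continuity of the nonlinear Young integral in the integrand path.**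
For `α + βγ > 1` and `δ < (α + βγ - 1)/γ`, there is `C₃ = C₃(α,β,γ,δ,T)` such that
`‖∫ A(du,x_u) - ∫ A(du,y_u)‖_α ≤ C₃ ‖A‖_{α,β,R} (1 + ‖x‖_γ + ‖y‖_γ) (sup ‖x-y‖)^δ`
whenever `R ≥ ‖x‖_∞ ∨ ‖y‖_∞`. -/
theorem nonlinear_young_integral_holder_in_path
    {V W : Type*} [NormedAddCommGroup V] [NormedSpace ℝ V]
    [NormedAddCommGroup W] [NormedSpace ℝ W]
    (α β γ δ : ℝ) (hα0 : 0 < α) (hα1 : α < 1) (hβ0 : 0 < β) (hβ1 : β < 1)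
    (hγ0 : 0 < γ) (hγ1 : γ < 1) (hδ0 : 0 < δ) (hδ1 : δ < 1)
    (hαβγ : 1 < α + β * γ) (hδ : δ < (α + β * γ - 1) / γ)
    (T : ℝ) (hT : 0 < T) :
    ∃ C₃ : ℝ, 0 ≤ C₃ ∧
      ∀ (A : ℝ → V → W) (x y : ℝ → V) (Ix Iy : ℝ → W) (R M Kx Ky D : ℝ),
        (∀ z : V, A 0 z = 0) →
        (∀ R' : ℝ, 0 ≤ R' → ∃ M' : ℝ,
          (∀ s t : ℝ, ∀ z : V, 0 ≤ s → s ≤ t → t ≤ T → ‖z‖ ≤ R' →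
            ‖A t z - A s z‖ ≤ M' * (t - s) ^ α) ∧
          (∀ s t : ℝ, ∀ z w : V, 0 ≤ s → s ≤ t → t ≤ T → ‖z‖ ≤ R' → ‖w‖ ≤ R' →
            ‖A t z - A s z - (A t w - A s w)‖ ≤ M' * (t - s) ^ α * ‖z - w‖ ^ β)) →
        (∀ t : ℝ, 0 ≤ t → t ≤ T → ‖x t‖ ≤ Kx) →
        (∀ s t : ℝ, 0 ≤ s → s ≤ t → t ≤ T → ‖x t - x s‖ ≤ Kx * (t - s) ^ γ) →
        (∀ t : ℝ, 0 ≤ t → t ≤ T → ‖y t‖ ≤ Ky) →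
        (∀ s t : ℝ, 0 ≤ s → s ≤ t → t ≤ T → ‖y t - y s‖ ≤ Ky * (t - s) ^ γ) →
        (∀ t : ℝ, 0 ≤ t → t ≤ T → ‖x t‖ ≤ R) →
        (∀ t : ℝ, 0 ≤ t → t ≤ T → ‖y t‖ ≤ R) →
        (∀ s t : ℝ, ∀ z : V, 0 ≤ s → s ≤ t → t ≤ T → ‖z‖ ≤ R →
          ‖A t z - A s z‖ ≤ M * (t - s) ^ α) →
        (∀ s t : ℝ, ∀ z w : V, 0 ≤ s → s ≤ t → t ≤ T → ‖z‖ ≤ R → ‖w‖ ≤ R →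
          ‖A t z - A s z - (A t w - A s w)‖ ≤ M * (t - s) ^ α * ‖z - w‖ ^ β) →
        (∀ t : ℝ, 0 ≤ t → t ≤ T → ‖x t - y t‖ ≤ D) →
        Ix 0 = 0 → Iy 0 = 0 →
        (∃ K : ℝ, ∀ s t : ℝ, 0 ≤ s → s ≤ t → t ≤ T →
          ‖Ix t - Ix s - (A t (x s) - A s (x s))‖ ≤ K * (t - s) ^ (α + β * γ)) →
        (∃ K : ℝ, ∀ s t : ℝ, 0 ≤ s → s ≤ t → t ≤ T →
          ‖Iy t - Iy s - (A t (y s) - A s (y s))‖ ≤ K * (t - s) ^ (α + β * γ)) →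
        supNormOn T (fun t => Ix t - Iy t) + holderSemiOn α T (fun t => Ix t - Iy t) ≤
          C₃ * M * (1 + Kx + Ky) * D ^ δ := by
  have hδβ : δ * γ < α + β * γ - 1 := (lt_div_iff₀ hγ0).1 hδ
  have hlt : δ < β := lt_of_mul_lt_mul_right (by linarith) hγ0.le
  set μ : ℝ := α + γ * (β - δ) with hμ_def
  have hμ : 1 < μ := by rw [hμ_def]; linarith
  have hμα : 0 < γ * (β - δ) := mul_pos hγ0 (by linarith)
  have hq1 : (2 : ℝ) ^ (1 - μ) < 1 :=
    Real.rpow_lt_one_of_one_lt_of_neg (by norm_num) (by linarith)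
  have hq : 0 < 1 - (2 : ℝ) ^ (1 - μ) := by linarith
  set Q : ℝ := 2 / (1 - (2 : ℝ) ^ (1 - μ)) with hQ_def
  have hQ : 0 < Q := by positivity
  refine ⟨(T ^ α + 1) * (1 + Q * T ^ (γ * (β - δ))), by positivity, ?_⟩
  intro A x y Ix Iy R M Kx Ky D _ _ hx hxγ hy hyγ hxR hyR hA hAβ hD hIx0 hIy0 hIx hIy
  obtain ⟨K₁, hK₁⟩ := hIx
  obtain ⟨K₂, hK₂⟩ := hIy
  have hKx : 0 ≤ Kx := (norm_nonneg _).trans (hx 0 le_rfl hT.le)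
  have hKy : 0 ≤ Ky := (norm_nonneg _).trans (hy 0 le_rfl hT.le)
  have hD0 : 0 ≤ D := (norm_nonneg _).trans (hD 0 le_rfl hT.le)
  have hM : 0 ≤ M := by
    have h := (norm_nonneg _).trans (hA 0 T (x 0) le_rfl hT.le le_rfl (hxR 0 le_rfl hT.le))
    rw [sub_zero] at h
    exact nonneg_of_mul_nonneg_left h (by positivity)
  set N : ℝ := 1 + Kx + Ky with hN_def
  have hN : 1 ≤ N := by linarith
  have hΞ (s t : ℝ) (hs : 0 ≤ s) (hst : s ≤ t) (ht : t ≤ T) :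
      ‖A t (x s) - A s (x s) - (A t (y s) - A s (y s))‖ ≤ M * N * D ^ δ * (t - s) ^ α := by
    have hsT : s ≤ T := hst.trans ht
    have hts : 0 ≤ t - s := by linarith
    have hxy : ‖x s - y s‖ ≤ N * 1 := by
      linarith [norm_sub_le (x s) (y s), hx s hs hsT, hy s hs hsT]
    have hpow := rpow_le_of_le_of_le_mul (norm_nonneg _) (hD s hs hsT) hN zero_le_one hxy
      hδ0 hlt (by linarith)
    rw [Real.one_rpow, mul_one] at hpow
    calc _ ≤ M * (t - s) ^ α * ‖x s - y s‖ ^ β :=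
          hAβ s t _ _ hs hst ht (hxR s hs hsT) (hyR s hs hsT)
      _ ≤ M * (t - s) ^ α * (D ^ δ * N) := by gcongr
      _ = _ := by ring
  have hdefect (s u t : ℝ) (hs : 0 ≤ s) (hsu : s ≤ u) (hut : u ≤ t) (ht : t ≤ T) :
      ‖(A t (x s) - A u (x s) - (A t (x u) - A u (x u))) -
        (A t (y s) - A u (y s) - (A t (y u) - A u (y u)))‖ ≤
        2 * (M * N * D ^ δ) * (t - s) ^ μ := by
    have huT : u ≤ T := hut.trans ht
    have hsT : s ≤ T := hsu.trans huT
    have hu : 0 ≤ u := hs.trans hsu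
    have hts : 0 ≤ t - s := by linarith
    have htu : 0 ≤ t - u := by linarith
    have hus : 0 ≤ u - s := by linarith
    have hmin : ‖(A t (x s) - A u (x s) - (A t (x u) - A u (x u))) -
        (A t (y s) - A u (y s) - (A t (y u) - A u (y u)))‖ ≤
        2 * (M * (t - u) ^ α * min D (N * (t - s) ^ γ) ^ β) := by
      rcases le_total D (N * (t - s) ^ γ) with h | h
      · rw [min_eq_left h]
        have bound (v : ℝ) (hv : 0 ≤ v) (hvT : v ≤ T) :
            ‖A t (x v) - A u (x v) - (A t (y v) - A u (y v))‖ ≤ M * (t - u) ^ α * D ^ β :=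
          (hAβ u t _ _ hu hut ht (hxR v hv hvT) (hyR v hv hvT)).trans
            (by gcongr; exact hD v hv hvT)
        rw [sub_sub_sub_comm]
        exact (norm_sub_le _ _).trans (by linarith [bound s hs hsT, bound u hu huT])
      · rw [min_eq_right h]
        have bound (z : ℝ → V) (k : ℝ) (hk : 0 ≤ k) (hkN : k ≤ N)
            (hz : ∀ t : ℝ, 0 ≤ t → t ≤ T → ‖z t‖ ≤ R)
            (hzγ : ∀ s t : ℝ, 0 ≤ s → s ≤ t → t ≤ T → ‖z t - z s‖ ≤ k * (t - s) ^ γ) :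
            ‖A t (z s) - A u (z s) - (A t (z u) - A u (z u))‖ ≤
              M * (t - u) ^ α * (N * (t - s) ^ γ) ^ β := by
          refine (hAβ u t _ _ hu hut ht (hz s hs hsT) (hz u hu huT)).trans ?_
          gcongr
          rw [norm_sub_rev]
          exact (hzγ s u hs hsu huT).trans (by gcongr)
        exact (norm_sub_le _ _).trans (by
          linarith [bound x Kx hKx (by linarith) hxR hxγ, bound y Ky hKy (by linarith) hyR hyγ])
    have hpow := rpow_le_of_le_of_le_mul (le_min hD0 (by positivity)) (min_le_left _ _) hN
      (by positivity) (min_le_right D (N * (t - s) ^ γ)) hδ0 hlt (by linarith)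
    rw [← Real.rpow_mul hts] at hpow
    calc _ ≤ _ := hmin
      _ ≤ 2 * (M * (t - s) ^ α * (D ^ δ * (N * (t - s) ^ (γ * (β - δ))))) := by
        gcongr
      _ = _ := by
        rw [hμ_def, Real.rpow_add_of_nonneg hts hα0.le hμα.le]
        ring
  set F : ℝ → ℝ → W := fun s t => Ix t - Iy t - (Ix s - Iy s) -
    (A t (x s) - A s (x s) - (A t (y s) - A s (y s))) with hF_def
  have hF (s t : ℝ) (hs : 0 ≤ s) (hst : s ≤ t) (ht : t ≤ T) :
      ‖F s t‖ ≤ Q * (M * N * D ^ δ) * (t - s) ^ μ := by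
    have h := norm_le_of_additivity_defect (T := T) (B := 2 * (M * N * D ^ δ))
      (L := (|K₁| + |K₂|) * T ^ (γ * δ)) hμ F ?_ ?_ hs hst ht
    · exact h.trans_eq (by rw [hQ_def]; ring)
    · intro s t hs hst ht
      have hts : 0 ≤ t - s := by linarith
      have hsplit : F s t = (Ix t - Ix s - (A t (x s) - A s (x s))) -
          (Iy t - Iy s - (A t (y s) - A s (y s))) := by
        simp only [hF_def]
        abel
      calc ‖F s t‖ ≤ K₁ * (t - s) ^ (α + β * γ) + K₂ * (t - s) ^ (α + β * γ) := by
            rw [hsplit]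
            exact (norm_sub_le _ _).trans (add_le_add (hK₁ s t hs hst ht) (hK₂ s t hs hst ht))
        _ ≤ |K₁| * (t - s) ^ (α + β * γ) + |K₂| * (t - s) ^ (α + β * γ) := by
            gcongr <;> exact le_abs_self _
        _ = (|K₁| + |K₂|) * (t - s) ^ (γ * δ) * (t - s) ^ μ := by
            rw [show α + β * γ = γ * δ + μ by rw [hμ_def]; ring,
              Real.rpow_add_of_nonneg hts (by positivity) (by linarith)]
            ring
        _ ≤ _ := by
            gcongr
            linarith
    · intro s u t hs hsu hut ht
      refine le_trans (le_of_eq ?_) (hdefect s u t hs hsu hut ht)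
      rw [← norm_neg]
      congr 1
      simp only [hF_def]
      abel
  have hinc (s t : ℝ) (hs : 0 ≤ s) (hst : s ≤ t) (ht : t ≤ T) :
      ‖Ix t - Iy t - (Ix s - Iy s)‖ ≤
        (1 + Q * T ^ (γ * (β - δ))) * (M * N * D ^ δ) * (t - s) ^ α := by
    have hts : 0 ≤ t - s := by linarith
    calc ‖Ix t - Iy t - (Ix s - Iy s)‖
        ≤ ‖F s t‖ + ‖A t (x s) - A s (x s) - (A t (y s) - A s (y s))‖ := by
          refine le_trans (le_of_eq ?_) (norm_add_le _ _)
          simp only [hF_def, sub_add_cancel]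
      _ ≤ Q * (M * N * D ^ δ) * ((t - s) ^ α * (t - s) ^ (γ * (β - δ))) +
          M * N * D ^ δ * (t - s) ^ α := by
          rw [← Real.rpow_add_of_nonneg hts hα0.le hμα.le]
          exact add_le_add (hF s t hs hst ht) (hΞ s t hs hst ht)
      _ ≤ Q * (M * N * D ^ δ) * ((t - s) ^ α * T ^ (γ * (β - δ))) +
          M * N * D ^ δ * (t - s) ^ α := by
          gcongr
          linarith
      _ = _ := by ring
  refine (supNormOn_add_holderSemiOn_le hα0 hT.le (by positivity) ?_ hinc).trans_eq (by ring)
  simp [hIx0, hIy0]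
end

section
/- Itô-type formula for nonlinear Young calculus: Let α, β, γ ∈ (0,1) with α + βγ > 1, let F : [0,T] × V → W be such that ‖F‖_{α,β,R} < ∞ for every R ≥ 0 (norms computed with the time increments F_{s,t}(z) := F(t,z) − F(s,z)), and let x ∈ C^γ([0,T];V). Then for every t ∈ [0,T] and every sequence of partitions 0 = t_0 < t_1 < … < t_k = t of [0,t] with mesh tending to 0, both families of Riemann sums Σ_i [F(t_{i+1}, x_{t_i}) − F(t_i, x_{t_i})] and Σ_i [F(t_i, x_{t_{i+1}}) − F(t_i, x_{t_i})] converge in W, and the sum of the two limits equals F(t, x_t) − F(0, x_0); i.e. F(t,x_t) − F(0,x_0) = ∫_0^t F(ds, x_s) + ∫_0^t F(s, dx_s). -/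
open Finset Filter Topology

/-- A two-parameter map whose additivity defect on `[a, b]` is of order `θ > 1` differs from its
Riemann sums by at most a constant times the `θ`-th power of the length of the interval. -/
theorem norm_riemannSum_sub_le {W : Type*} [NormedAddCommGroup W] {A : ℝ → ℝ → W}
    {a b C K θ : ℝ} (hθ : 0 < θ) (hC : 0 ≤ C) (hK : 0 ≤ K)
    (hCK : 2 * C + 2 * (K * (1 / 2) ^ θ) ≤ K) (hA0 : ∀ s, A s s = 0)
    (hA : ∀ s u t, a ≤ s → s ≤ u → u ≤ t → t ≤ b →
      ‖A s t - A s u - A u t‖ ≤ C * (t - s) ^ θ)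
    (n : ℕ) (q : ℕ → ℝ) (hq : Monotone q) (ha : a ≤ q 0) (hb : q n ≤ b) :
    ‖∑ i ∈ range n, A (q i) (q (i + 1)) - A (q 0) (q n)‖ ≤ K * (q n - q 0) ^ θ := by
  induction n using Nat.strong_induction_on generalizing q with
  | _ n ih =>
  have h0n : q 0 ≤ q n := hq (Nat.zero_le n)
  rcases h0n.eq_or_lt with h | h
  · have hz : ∀ i ∈ range n, A (q i) (q (i + 1)) = 0 := by
      intro i hi
      have h1 : q i = q 0 := le_antisymm ((hq (mem_range.1 hi).le).trans h.ge) (hq (Nat.zero_le i))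
      have h2 : q (i + 1) = q 0 :=
        le_antisymm ((hq (Nat.succ_le_of_lt (mem_range.1 hi))).trans h.ge) (hq (Nat.zero_le _))
      rw [h1, h2, hA0]
    rw [sum_eq_zero hz, ← h, hA0]
    simp [Real.zero_rpow hθ.ne']
  · set L := q n - q 0 with hL
    have hLpos : 0 < L := sub_pos.2 h
    obtain ⟨l, r, hlr, hl, hr⟩ : ∃ l r, l + 1 + r = n ∧ q l - q 0 ≤ L * (1 / 2) ∧
        q n - q (l + 1) ≤ L * (1 / 2) := by
      classical
      have hex : ∃ j, q 0 + L * (1 / 2) < q j := ⟨n, by linarith⟩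
      have hspec := Nat.find_spec hex
      have hle : Nat.find hex ≤ n := Nat.find_min' hex (by linarith)
      have hmin := fun m (hm : m < Nat.find hex) => Nat.find_min hex hm
      generalize Nat.find hex = j at *
      obtain _ | l := j
      · linarith
      · refine ⟨l, n - (l + 1), by omega, ?_, by linarith⟩
        have := hmin l (Nat.lt_succ_self l)
        linarith
    have hln : q (l + 1) ≤ q n := hq (by omega)
    have hll : q l ≤ q (l + 1) := hq (Nat.le_succ l)
    have h0l : q 0 ≤ q l := hq (Nat.zero_le l)
    have hhalf : ∀ y, 0 ≤ y → y ≤ L * (1 / 2) → K * y ^ θ ≤ K * (1 / 2) ^ θ * L ^ θ := by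
      intro y hy hyL
      calc K * y ^ θ ≤ K * (L * (1 / 2)) ^ θ := by gcongr
        _ = K * (1 / 2) ^ θ * L ^ θ := by
          rw [Real.mul_rpow hLpos.le (by norm_num)]; ring
    have e1 := (ih l (by omega) q hq ha (by linarith)).trans (hhalf _ (by linarith) hl)
    have e2 := ih r (by omega) (fun i => q (l + 1 + i)) (fun i j hij => hq (by omega))
      (by simpa using by linarith) (by simpa [hlr] using hb)
    simp only [add_zero, hlr] at e2
    replace e2 := e2.trans (hhalf _ (by linarith) hr)
    have e3 : ‖A (q 0) (q n) - A (q 0) (q l) - A (q l) (q n)‖ ≤ C * L ^ θ :=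
      hA _ _ _ ha h0l (by linarith) hb
    have e4 : ‖A (q l) (q n) - A (q l) (q (l + 1)) - A (q (l + 1)) (q n)‖ ≤ C * L ^ θ := by
      refine (hA _ _ _ (by linarith) hll hln hb).trans ?_
      gcongr
      all_goals linarith
    have hsum : ∑ i ∈ range n, A (q i) (q (i + 1)) =
        ∑ i ∈ range l, A (q i) (q (i + 1)) + A (q l) (q (l + 1)) +
          ∑ i ∈ range r, A (q (l + 1 + i)) (q (l + 1 + (i + 1))) := by
      rw [← hlr, sum_range_add, sum_range_succ]
      rfl
    have hsplit : ∑ i ∈ range n, A (q i) (q (i + 1)) - A (q 0) (q n) =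
        (∑ i ∈ range l, A (q i) (q (i + 1)) - A (q 0) (q l)) +
        (∑ i ∈ range r, A (q (l + 1 + i)) (q (l + 1 + (i + 1))) - A (q (l + 1)) (q n)) -
        (A (q 0) (q n) - A (q 0) (q l) - A (q l) (q n)) -
        (A (q l) (q n) - A (q l) (q (l + 1)) - A (q (l + 1)) (q n)) := by
      rw [hsum]; abel
    rw [hsplit]
    refine (norm_sub_le _ _).trans ?_
    refine (add_le_add ((norm_sub_le _ _).trans (add_le_add (norm_add_le _ _) le_rfl)) le_rfl).trans
      ?_
    have hLθ : 0 ≤ L ^ θ := Real.rpow_nonneg hLpos.le θ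
    have := mul_le_mul_of_nonneg_right hCK hLθ
    linarith

/-- Clamping `[u, v]` to `[s, t]` and clamping `[s, t]` to `[u, v]` give the same interval, unless
both results are degenerate. -/
theorem apply_clamp_comm {W : Type*} [Zero W] {A : ℝ → ℝ → W} (hA0 : ∀ s, A s s = 0)
    {s t u v : ℝ} (hst : s ≤ t) (huv : u ≤ v) :
    A (max s (min u t)) (max s (min v t)) = A (max u (min s v)) (max u (min t v)) := by
  rcases lt_or_ge t u with h | h
  · rw [min_eq_right h.le, min_eq_right (h.le.trans huv), hA0, min_eq_left (h.le.trans huv),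
      max_eq_left h.le, min_eq_left (hst.trans (h.le.trans huv)), max_eq_left (hst.trans h.le), hA0]
  · rcases lt_or_ge v s with h' | h'
    · rw [min_eq_left h, min_eq_left (h'.le.trans hst), max_eq_left h'.le,
        max_eq_left (huv.trans h'.le), hA0, min_eq_right h'.le, min_eq_right (h'.le.trans hst), hA0]
    · rw [min_eq_left h, min_eq_left h', max_comm u s, max_eq_right (le_min h' hst),
        max_eq_right (le_min h huv), min_comm]

/-- The Riemann sum over a partition differs from the one over its common refinement with a second
partition by at most a constant times the sum of the `θ`-th powers of the steps. -/
theorem norm_riemannSum_sub_refinement_le {W : Type*} [NormedAddCommGroup W] {A : ℝ → ℝ → W}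
    {a b C K θ : ℝ} (hθ : 0 < θ) (hC : 0 ≤ C) (hK : 0 ≤ K)
    (hCK : 2 * C + 2 * (K * (1 / 2) ^ θ) ≤ K) (hA0 : ∀ s, A s s = 0)
    (hA : ∀ s u t, a ≤ s → s ≤ u → u ≤ t → t ≤ b →
      ‖A s t - A s u - A u t‖ ≤ C * (t - s) ^ θ)
    {m n : ℕ} {p q : ℕ → ℝ} (hp : Monotone p) (hq : Monotone q)
    (hp0 : p 0 = a) (hpm : p m = b) (hq0 : q 0 = a) (hqn : q n = b) :
    ‖∑ i ∈ range m, ∑ j ∈ range n,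
        A (max (p i) (min (q j) (p (i + 1)))) (max (p i) (min (q (j + 1)) (p (i + 1)))) -
      ∑ i ∈ range m, A (p i) (p (i + 1))‖ ≤ K * ∑ i ∈ range m, (p (i + 1) - p i) ^ θ := by
  rw [← sum_sub_distrib, mul_sum]
  refine norm_sum_le_of_le _ fun i hi => ?_
  have h1 : a ≤ p i := hp0 ▸ hp (Nat.zero_le i)
  have h2 : p i ≤ p (i + 1) := hp (Nat.le_succ i)
  have h3 : p (i + 1) ≤ b := hpm ▸ hp (Nat.succ_le_of_lt (mem_range.1 hi))
  have r0 : max (p i) (min (q 0) (p (i + 1))) = p i :=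
    max_eq_left ((min_le_left _ _).trans (hq0.le.trans h1))
  have rn : max (p i) (min (q n) (p (i + 1))) = p (i + 1) := by
    rw [hqn, min_eq_right h3, max_eq_right h2]
  have key := norm_riemannSum_sub_le hθ hC hK hCK hA0 hA n
    (fun j => max (p i) (min (q j) (p (i + 1))))
    (fun j k hjk => max_le_max le_rfl (min_le_min (hq hjk) le_rfl))
    (r0.symm ▸ h1) (rn.symm ▸ h3)
  simpa only [r0, rn] using key

/-- The Riemann sums over two partitions of the same interval differ by at most a constant times
the total of the sums of the `θ`-th powers of their steps. -/
theorem dist_riemannSum_le {W : Type*} [NormedAddCommGroup W] {A : ℝ → ℝ → W}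
    {a b C K θ : ℝ} (hθ : 0 < θ) (hC : 0 ≤ C) (hK : 0 ≤ K)
    (hCK : 2 * C + 2 * (K * (1 / 2) ^ θ) ≤ K) (hA0 : ∀ s, A s s = 0)
    (hA : ∀ s u t, a ≤ s → s ≤ u → u ≤ t → t ≤ b →
      ‖A s t - A s u - A u t‖ ≤ C * (t - s) ^ θ)
    {m n : ℕ} {p q : ℕ → ℝ} (hp : Monotone p) (hq : Monotone q)
    (hp0 : p 0 = a) (hpm : p m = b) (hq0 : q 0 = a) (hqn : q n = b) :
    dist (∑ i ∈ range m, A (p i) (p (i + 1))) (∑ i ∈ range n, A (q i) (q (i + 1))) ≤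
      K * (∑ i ∈ range m, (p (i + 1) - p i) ^ θ + ∑ i ∈ range n, (q (i + 1) - q i) ^ θ) := by
  have h1 := norm_riemannSum_sub_refinement_le hθ hC hK hCK hA0 hA hp hq hp0 hpm hq0 hqn
  have h2 := norm_riemannSum_sub_refinement_le hθ hC hK hCK hA0 hA hq hp hq0 hqn hp0 hpm
  rw [sum_comm] at h2
  simp only [fun i j => apply_clamp_comm hA0 (hq (Nat.le_succ j)) (hp (Nat.le_succ i))] at h2
  rw [← dist_eq_norm] at h1 h2
  rw [mul_add]
  exact (dist_triangle_left _ _ _).trans (add_le_add h1 h2)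

/-- Along partitions of an interval with vanishing mesh, the sums of the `θ`-th powers of the steps
tend to `0` when `θ > 1`. -/
theorem tendsto_sum_rpow_steps {θ t : ℝ} (hθ : 1 < θ) {k : ℕ → ℕ} {p : ℕ → ℕ → ℝ}
    (hp : ∀ n, Monotone (p n)) (hp0 : ∀ n, p n 0 = 0) (hpk : ∀ n, p n (k n) = t)
    (hmesh : ∀ ε : ℝ, 0 < ε → ∃ N : ℕ, ∀ n, N ≤ n → ∀ i, i < k n → p n (i + 1) - p n i < ε) :
    Tendsto (fun n => ∑ i ∈ range (k n), (p n (i + 1) - p n i) ^ θ) atTop (𝓝 0) := by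
  have hstep : ∀ n i, 0 ≤ p n (i + 1) - p n i := fun n i => sub_nonneg.2 (hp n (Nat.le_succ i))
  have hbound : ∀ n δ, 0 < δ → (∀ i, i < k n → p n (i + 1) - p n i < δ) →
      ∑ i ∈ range (k n), (p n (i + 1) - p n i) ^ θ ≤ δ ^ (θ - 1) * t := by
    intro n δ hδ h
    calc ∑ i ∈ range (k n), (p n (i + 1) - p n i) ^ θ
        ≤ ∑ i ∈ range (k n), δ ^ (θ - 1) * (p n (i + 1) - p n i) := by
          refine sum_le_sum fun i hi => ?_
          have hi' := (h i (mem_range.1 hi)).le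
          have h0 := hstep n i
          generalize p n (i + 1) - p n i = y at *
          calc y ^ θ = y ^ (θ - 1) * y := by
                rw [← Real.rpow_add_one' h0 (by linarith), sub_add_cancel]
            _ ≤ δ ^ (θ - 1) * y := by
                gcongr
      _ = δ ^ (θ - 1) * t := by
          rw [← mul_sum, sum_range_sub, hpk, hp0, sub_zero]
  have hlim : Tendsto (fun δ : ℝ => δ ^ (θ - 1) * t) (𝓝[>] 0) (𝓝 0) := by
    have : ContinuousAt (fun δ : ℝ => δ ^ (θ - 1) * t) 0 :=
      (Real.continuousAt_rpow_const 0 (θ - 1) (Or.inr (by linarith))).mul continuousAt_const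
    have h := this.tendsto.mono_left (nhdsWithin_le_nhds (s := Set.Ioi 0))
    simpa [Real.zero_rpow (by linarith : θ - 1 ≠ 0)] using h
  refine tendsto_order.2 ⟨fun c hc => Eventually.of_forall fun n =>
    hc.trans_le (sum_nonneg fun i _ => Real.rpow_nonneg (hstep n i) θ), fun c hc => ?_⟩
  obtain ⟨δ, hδc, hδ⟩ := ((hlim.eventually_lt_const hc).and self_mem_nhdsWithin).exists
  obtain ⟨N, hN⟩ := hmesh δ hδ
  filter_upwards [eventually_ge_atTop N] with n hn
  exact (hbound n δ hδ (hN n hn)).trans_lt hδc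

/-- Riemann sums of a two-parameter map with additivity defect of order `θ > 1` converge along
partitions with vanishing mesh. -/
theorem exists_tendsto_riemannSum {W : Type*} [NormedAddCommGroup W] [CompleteSpace W]
    {A : ℝ → ℝ → W} {t C θ : ℝ} (hθ : 1 < θ) (hC : 0 ≤ C) (hA0 : ∀ s, A s s = 0)
    (hA : ∀ s u r, 0 ≤ s → s ≤ u → u ≤ r → r ≤ t →
      ‖A s r - A s u - A u r‖ ≤ C * (r - s) ^ θ)
    {k : ℕ → ℕ} {p : ℕ → ℕ → ℝ}
    (hp : ∀ n, Monotone (p n)) (hp0 : ∀ n, p n 0 = 0) (hpk : ∀ n, p n (k n) = t)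
    (hmesh : ∀ ε : ℝ, 0 < ε → ∃ N : ℕ, ∀ n, N ≤ n → ∀ i, i < k n → p n (i + 1) - p n i < ε) :
    ∃ L, Tendsto (fun n => ∑ i ∈ range (k n), A (p n i) (p n (i + 1))) atTop (𝓝 L) := by
  obtain ⟨K, hK, hCK⟩ : ∃ K : ℝ, 0 ≤ K ∧ 2 * C + 2 * (K * (1 / 2) ^ θ) ≤ K := by
    have hlt : (1 / 2 : ℝ) ^ θ < 1 / 2 := by
      simpa using Real.rpow_lt_rpow_of_exponent_gt (x := (1 / 2 : ℝ)) (by norm_num) (by norm_num) hθ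
    have hpos : 0 < 1 - 2 * (1 / 2 : ℝ) ^ θ := by linarith
    refine ⟨2 * C / (1 - 2 * (1 / 2 : ℝ) ^ θ), by positivity, le_of_eq ?_⟩
    generalize (1 / 2 : ℝ) ^ θ = c at *
    field_simp
    ring
  have hV := tendsto_sum_rpow_steps hθ hp hp0 hpk hmesh
  refine cauchySeq_tendsto_of_complete (cauchySeq_iff_tendsto_dist_atTop_0.2 ?_)
  have hVV : Tendsto (fun mn : ℕ × ℕ =>
      K * (∑ i ∈ range (k mn.1), (p mn.1 (i + 1) - p mn.1 i) ^ θ +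
        ∑ i ∈ range (k mn.2), (p mn.2 (i + 1) - p mn.2 i) ^ θ)) atTop (𝓝 0) := by
    rw [← prod_atTop_atTop_eq]
    simpa using ((hV.comp tendsto_fst).add (hV.comp tendsto_snd)).const_mul K
  exact squeeze_zero (fun _ => dist_nonneg) (fun mn =>
    dist_riemannSum_le (by linarith) hC hK hCK hA0 hA (hp mn.1) (hp mn.2) (hp0 _) (hpk _)
      (hp0 _) (hpk _)) hVV

/-- **Itô-type formula for nonlinear Young calculus.**  Let `α + βγ > 1`, let
`F : [0,T] × V → W` have finite `‖F‖_{α,β,R}` for every `R ≥ 0`, and let `x ∈ C^γ([0,T];V)`.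
Then along every sequence of partitions of `[0,t]` with vanishing mesh, the two families of
Riemann sums `Σ_i [F(t_{i+1}, x_{t_i}) - F(t_i, x_{t_i})]` and
`Σ_i [F(t_i, x_{t_{i+1}}) - F(t_i, x_{t_i})]` converge in `W`, and the sum of the two limits
equals `F(t, x_t) - F(0, x_0)`. -/
theorem ito_formula_nonlinear_young
    {V W : Type*} [NormedAddCommGroup V] [NormedSpace ℝ V]
    [NormedAddCommGroup W] [NormedSpace ℝ W] [CompleteSpace W]
    (α β γ : ℝ) (hα0 : 0 < α) (hα1 : α < 1) (hβ0 : 0 < β) (hβ1 : β < 1)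
    (hγ0 : 0 < γ) (hγ1 : γ < 1) (hαβγ : 1 < α + β * γ)
    (T : ℝ) (hT : 0 < T)
    (F : ℝ → V → W)
    (hF : ∀ R : ℝ, 0 ≤ R → ∃ M : ℝ,
      (∀ s t : ℝ, ∀ z : V, 0 ≤ s → s ≤ t → t ≤ T → ‖z‖ ≤ R →
        ‖F t z - F s z‖ ≤ M * (t - s) ^ α) ∧
      (∀ s t : ℝ, ∀ z w : V, 0 ≤ s → s ≤ t → t ≤ T → ‖z‖ ≤ R → ‖w‖ ≤ R →
        ‖F t z - F s z - (F t w - F s w)‖ ≤ M * (t - s) ^ α * ‖z - w‖ ^ β))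
    (x : ℝ → V) (Kx : ℝ)
    (hx : ∀ s t : ℝ, 0 ≤ s → s ≤ t → t ≤ T → ‖x t - x s‖ ≤ Kx * (t - s) ^ γ) :
    ∀ t : ℝ, 0 ≤ t → t ≤ T →
      ∀ (k : ℕ → ℕ) (p : ℕ → ℕ → ℝ),
        (∀ n, p n 0 = 0) → (∀ n, p n (k n) = t) →
        (∀ n i, i < k n → p n i < p n (i + 1)) →
        (∀ ε : ℝ, 0 < ε → ∃ N : ℕ, ∀ n, N ≤ n → ∀ i, i < k n → p n (i + 1) - p n i < ε) →
        ∃ L₁ L₂ : W,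
          Filter.Tendsto
            (fun n => ∑ i ∈ Finset.range (k n),
              (F (p n (i + 1)) (x (p n i)) - F (p n i) (x (p n i))))
            Filter.atTop (nhds L₁) ∧
          Filter.Tendsto
            (fun n => ∑ i ∈ Finset.range (k n),
              (F (p n i) (x (p n (i + 1))) - F (p n i) (x (p n i))))
            Filter.atTop (nhds L₂) ∧
          L₁ + L₂ = F t (x t) - F 0 (x 0) := by
  intro t ht0 htT k p₀ hp0₀ hpk₀ hlt hmesh₀
  obtain ⟨p, hpeq, hp⟩ : ∃ p : ℕ → ℕ → ℝ, (∀ n i, i ≤ k n → p n i = p₀ n i) ∧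
      ∀ n, Monotone (p n) := by
    refine ⟨fun n i => p₀ n (min i (k n)), fun n i hi => by simp only [min_eq_left hi],
      fun n => monotone_nat_of_le_succ fun i => ?_⟩
    rcases lt_or_ge i (k n) with h | h
    · simpa only [min_eq_left h.le, min_eq_left (Nat.succ_le_of_lt h)] using (hlt n i h).le
    · simp only [min_eq_right h, min_eq_right (h.trans (Nat.le_succ i)), le_refl]
  have hp0 : ∀ n, p n 0 = 0 := fun n => (hpeq n 0 (Nat.zero_le _)).trans (hp0₀ n)
  have hpk : ∀ n, p n (k n) = t := fun n => (hpeq n _ le_rfl).trans (hpk₀ n)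
  have hpi : ∀ n, ∀ i ∈ range (k n), p₀ n i = p n i ∧ p₀ n (i + 1) = p n (i + 1) :=
    fun n i hi => ⟨(hpeq n i (mem_range.1 hi).le).symm,
      (hpeq n (i + 1) (Nat.succ_le_of_lt (mem_range.1 hi))).symm⟩
  have hmesh : ∀ ε : ℝ, 0 < ε →
      ∃ N : ℕ, ∀ n, N ≤ n → ∀ i, i < k n → p n (i + 1) - p n i < ε := by
    intro ε hε
    obtain ⟨N, hN⟩ := hmesh₀ ε hε
    refine ⟨N, fun n hn i hi => ?_⟩
    rw [← (hpi n i (mem_range.2 hi)).1, ← (hpi n i (mem_range.2 hi)).2]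
    exact hN n hn i hi
  have hS₁ : ∀ n, ∑ i ∈ range (k n), (F (p₀ n (i + 1)) (x (p₀ n i)) - F (p₀ n i) (x (p₀ n i))) =
      ∑ i ∈ range (k n), (F (p n (i + 1)) (x (p n i)) - F (p n i) (x (p n i))) :=
    fun n => sum_congr rfl fun i hi => by rw [(hpi n i hi).1, (hpi n i hi).2]
  have hS₂ : ∀ n, ∑ i ∈ range (k n), (F (p₀ n i) (x (p₀ n (i + 1))) - F (p₀ n i) (x (p₀ n i))) =
      ∑ i ∈ range (k n), (F (p n i) (x (p n (i + 1))) - F (p n i) (x (p n i))) :=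
    fun n => sum_congr rfl fun i hi => by rw [(hpi n i hi).1, (hpi n i hi).2]
  simp only [hS₁, hS₂]
  have hxK : ∀ s u : ℝ, 0 ≤ s → s ≤ u → u ≤ T → ‖x u - x s‖ ≤ |Kx| * (u - s) ^ γ :=
    fun s u h1 h2 h3 => (hx s u h1 h2 h3).trans
      (mul_le_mul_of_nonneg_right (le_abs_self Kx) (Real.rpow_nonneg (sub_nonneg.2 h2) γ))
  set R := ‖x 0‖ + |Kx| * T ^ γ with hR
  have hxR : ∀ s : ℝ, 0 ≤ s → s ≤ T → ‖x s‖ ≤ R := by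
    intro s h1 h2
    have h3 : ‖x s - x 0‖ ≤ |Kx| * T ^ γ := by
      refine (hxK 0 s le_rfl h1 h2).trans ?_
      gcongr
      all_goals linarith
    have h4 := norm_sub_norm_le (x s) (x 0)
    linarith
  obtain ⟨M, -, hM⟩ := hF R (by positivity)
  set θ := α + β * γ with hθ
  set C := |M| * |Kx| ^ β with hCdef
  have hC : 0 ≤ C := by positivity
  have hdefect : ∀ s u v r : ℝ, 0 ≤ s → s ≤ u → u ≤ r → s ≤ v → v ≤ r → r ≤ T →
      ‖F r (x u) - F v (x u) - (F r (x s) - F v (x s))‖ ≤ C * (r - s) ^ θ := by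
    intro s u v r hs hsu hur hsv hvr hrT
    have huT : u ≤ T := hur.trans hrT
    have hrs : 0 ≤ r - s := by linarith
    calc ‖F r (x u) - F v (x u) - (F r (x s) - F v (x s))‖
        ≤ M * (r - v) ^ α * ‖x u - x s‖ ^ β :=
          hM v r _ _ (by linarith) hvr hrT (hxR u (by linarith) huT) (hxR s hs (by linarith))
      _ ≤ |M| * (r - s) ^ α * (|Kx| * (r - s) ^ γ) ^ β := by
          have h1 : ‖x u - x s‖ ≤ |Kx| * (r - s) ^ γ := by
            refine (hxK s u hs hsu huT).trans ?_
            gcongr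
          have h2 : (r - v) ^ α ≤ (r - s) ^ α :=
            Real.rpow_le_rpow (by linarith) (by linarith) hα0.le
          have h3 := le_abs_self M
          have h4 : 0 ≤ (r - v) ^ α := Real.rpow_nonneg (by linarith) α
          gcongr
      _ = C * (r - s) ^ θ := by
          rw [Real.mul_rpow (abs_nonneg _) (Real.rpow_nonneg hrs γ), ← Real.rpow_mul hrs,
            hθ, Real.rpow_add_of_nonneg hrs hα0.le (by positivity), mul_comm γ β]
          ring
  obtain ⟨L₁, hL₁⟩ := exists_tendsto_riemannSum (A := fun s u => F u (x s) - F s (x s))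
    (t := t) hαβγ hC (fun s => sub_self _)
    (fun s u r hs hsu hur hrt => by
      have h := hdefect s u u r hs hsu hur hsu hur (hrt.trans htT)
      rw [norm_sub_rev] at h
      rwa [sub_sub_sub_cancel_right])
    hp hp0 hpk hmesh
  have herr : Tendsto (fun n => ∑ i ∈ range (k n),
      (F (p n (i + 1)) (x (p n (i + 1))) - F (p n i) (x (p n (i + 1))) -
        (F (p n (i + 1)) (x (p n i)) - F (p n i) (x (p n i))))) atTop (𝓝 0) := by
    have hV := (tendsto_sum_rpow_steps hαβγ hp hp0 hpk hmesh).const_mul C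
    rw [mul_zero] at hV
    refine squeeze_zero_norm (fun n => ?_) hV
    rw [mul_sum]
    refine norm_sum_le_of_le _ fun i hi => ?_
    have h1 : 0 ≤ p n i := hp0 n ▸ hp n (Nat.zero_le i)
    have h2 : p n i ≤ p n (i + 1) := hp n (Nat.le_succ i)
    have h3 : p n (i + 1) ≤ t := hpk n ▸ hp n (Nat.succ_le_of_lt (mem_range.1 hi))
    exact hdefect _ _ _ _ h1 h2 le_rfl le_rfl h2 (h3.trans htT)
  refine ⟨L₁, F t (x t) - F 0 (x 0) - L₁, hL₁, ?_, by abel⟩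
  have hlim := (tendsto_const_nhds (x := F t (x t) - F 0 (x 0)) (f := atTop)).sub hL₁ |>.sub herr
  rw [sub_zero] at hlim
  refine hlim.congr fun n => ?_
  have htel : F t (x t) - F 0 (x 0) =
      ∑ i ∈ range (k n), (F (p n (i + 1)) (x (p n (i + 1))) - F (p n i) (x (p n i))) := by
    rw [sum_range_sub (fun i => F (p n i) (x (p n i))), hpk, hp0]
  rw [htel, ← sum_sub_distrib, ← sum_sub_distrib]
  exact sum_congr rfl fun i _ => by abel
end

section
/- Existence of solutions under a compactness assumption: Let V, W be Banach spaces such that W embeds continuously and compactly into V, let α, β ∈ (0,1) with α(1+β) > 1, and let A ∈ C^α_t C^β_{V,W}. Then for every x₀ ∈ V there exist x ∈ C^α([0,T];V) with x(0) = x₀ and a constant K ≥ 0 such that ‖x_t − x_s − A_{s,t}(x_s)‖_V ≤ K (t−s)^{α(1+β)} for all 0 ≤ s ≤ t ≤ T; that is, x is a solution of the nonlinear Young differential equation x_t = x₀ + ∫_0^t A(ds, x_s). -/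
open Filter Topology

/-- A sublinear perturbation of a strict contraction of the half-line admits an invariant
interval. -/
lemma exists_nonneg_mul_add_rpow_le {ρ β M c L : ℝ} (hρ : ρ < 1) (hβ0 : 0 < β) (hβ1 : β < 1)
    (hM : 0 ≤ M) (hc : 0 ≤ c) (hL : 0 ≤ L) :
    ∃ K : ℝ, 0 ≤ K ∧ ρ * K + M * (c * (M + K * L)) ^ β ≤ K := by
  have h1 : Tendsto (fun K : ℝ => K ^ (1 - β)) atTop atTop :=
    tendsto_rpow_atTop (by linarith)
  obtain ⟨K, hK, hK1⟩ := ((h1.eventually_ge_atTop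
    (M * (c * (M + L)) ^ β / (1 - ρ))).and (eventually_ge_atTop (1 : ℝ))).exists
  have hK0 : 0 < K := by linarith
  refine ⟨K, hK0.le, ?_⟩
  have h2 : (c * (M + K * L)) ^ β ≤ (c * (M + L)) ^ β * K ^ β := by
    rw [← Real.mul_rpow (by positivity) hK0.le]
    refine Real.rpow_le_rpow (by positivity) ?_ hβ0.le
    rw [mul_assoc]
    refine mul_le_mul_of_nonneg_left ?_ hc
    nlinarith
  have h3 : K ^ (1 - β) * K ^ β = K := by
    rw [← Real.rpow_add hK0]; simp
  have h4 : M * (c * (M + L)) ^ β ≤ K ^ (1 - β) * (1 - ρ) :=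
    (div_le_iff₀ (by linarith)).1 hK
  have h5 := mul_le_mul_of_nonneg_left h2 hM
  have h6 := mul_le_mul_of_nonneg_right h4 (Real.rpow_nonneg hK0.le β)
  have h7 : K ^ (1 - β) * (1 - ρ) * K ^ β = (1 - ρ) * K := by
    linear_combination (1 - ρ) * h3
  linarith

lemma rpow_add_rpow_le_of_balanced {a b r θ : ℝ} (ha : 0 ≤ a) (hb : 0 ≤ b) (hr : 0 ≤ r)
    (hθ : 1 ≤ θ) (har : a ≤ r * (a + b)) (hbr : b ≤ r * (a + b)) :
    a ^ θ + b ^ θ ≤ r ^ (θ - 1) * (a + b) ^ θ := by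
  have split {x : ℝ} (hx : 0 ≤ x) : x ^ θ = x * x ^ (θ - 1) := by
    conv_rhs => rw [← Real.rpow_one_add' hx (by linarith)]
    congr 1; ring
  have h1 := Real.rpow_le_rpow ha har (show 0 ≤ θ - 1 by linarith)
  have h2 := Real.rpow_le_rpow hb hbr (show 0 ≤ θ - 1 by linarith)
  rw [Real.mul_rpow hr (by positivity)] at h1 h2
  rw [split ha, split hb, split (add_nonneg ha hb)]
  nlinarith [mul_le_mul_of_nonneg_left h1 ha, mul_le_mul_of_nonneg_left h2 hb]

/-- A remainder of order `α (1 + β)` gives an `α`-Hölder increment. -/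
lemma norm_sub_le_of_remainder {W : Type*} [NormedAddCommGroup W] {α β T M K d : ℝ}
    {u v a : W} (hα : 0 ≤ α) (hβ : 0 ≤ β)
    (hK : 0 ≤ K) (hd : 0 ≤ d) (hdT : d ≤ T) (ha : ‖a‖ ≤ M * d ^ α)
    (hr : ‖v - u - a‖ ≤ K * d ^ (α * (1 + β))) :
    ‖v - u‖ ≤ (M + K * T ^ (α * β)) * d ^ α := by
  have h1 : d ^ (α * (1 + β)) = d ^ α * d ^ (α * β) := by
    rw [mul_add, mul_one, Real.rpow_add_of_nonneg hd hα (by positivity)]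
  have h2 : d ^ (α * β) ≤ T ^ (α * β) := Real.rpow_le_rpow hd hdT (by positivity)
  have h3 : ‖v - u‖ ≤ ‖v - u - a‖ + ‖a‖ := norm_le_norm_sub_add _ _
  have h4 : d ^ α * d ^ (α * β) ≤ d ^ α * T ^ (α * β) := by gcongr
  rw [h1] at hr
  nlinarith [mul_le_mul_of_nonneg_left h4 hK]

/-- Joint continuity of the increments `A t z - A s z` in `(s, t, z)` along a filter. -/
lemma tendsto_increment {V W : Type*} [NormedAddCommGroup V] [NormedAddCommGroup W]
    {α β T M : ℝ} {A : ℝ → V → W} (hα : 0 < α) (hβ : 0 < β)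
    (hAbd : ∀ s t : ℝ, ∀ z : V, 0 ≤ s → s ≤ t → t ≤ T → ‖A t z - A s z‖ ≤ M * (t - s) ^ α)
    (hAhol : ∀ s t : ℝ, ∀ z w : V, 0 ≤ s → s ≤ t → t ≤ T →
      ‖A t z - A s z - (A t w - A s w)‖ ≤ M * (t - s) ^ α * ‖z - w‖ ^ β)
    {X : Type*} {l : Filter X} {s t : ℝ} {σ τ : X → ℝ} {z : X → V} {w : V}
    (hs : 0 ≤ s) (hst : s ≤ t) (htT : t ≤ T)
    (hσ0 : ∀ n, 0 ≤ σ n) (hσs : ∀ n, σ n ≤ s) (hτ0 : ∀ n, 0 ≤ τ n) (hτt : ∀ n, τ n ≤ t)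
    (hσ : Tendsto σ l (𝓝 s)) (hτ : Tendsto τ l (𝓝 t)) (hz : Tendsto z l (𝓝 w)) :
    Tendsto (fun n => A (τ n) (z n) - A (σ n) (z n)) l (𝓝 (A t w - A s w)) := by
  rw [tendsto_iff_norm_sub_tendsto_zero]
  refine squeeze_zero (fun _ => norm_nonneg _) (g := fun n => M * (t - τ n) ^ α +
    M * (s - σ n) ^ α + M * (t - s) ^ α * ‖z n - w‖ ^ β) (fun n => ?_) ?_
  · have h1 := hAbd (τ n) t (z n) (hτ0 n) (hτt n) htT
    have h2 := hAbd (σ n) s (z n) (hσ0 n) (hσs n) (hst.trans htT)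
    have h3 := hAhol s t (z n) w hs hst htT
    have key : A (τ n) (z n) - A (σ n) (z n) - (A t w - A s w) =
        (A (τ n) (z n) - A t (z n)) + (A s (z n) - A (σ n) (z n)) +
        (A t (z n) - A s (z n) - (A t w - A s w)) := by abel
    rw [key]
    rw [norm_sub_rev] at h1
    exact norm_add₃_le.trans (by gcongr)
  · have pow0 {f : X → ℝ} {γ : ℝ} (hγ : 0 < γ) (hf : Tendsto f l (𝓝 0)) :
        Tendsto (fun n => f n ^ γ) l (𝓝 0) := by
      simpa [Real.zero_rpow hγ.ne'] using hf.rpow_const (p := γ) (Or.inr hγ.le)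
    have h1 : Tendsto (fun n => t - τ n) l (𝓝 0) := by simpa using hτ.const_sub t
    have h2 : Tendsto (fun n => s - σ n) l (𝓝 0) := by simpa using hσ.const_sub s
    have h3 := tendsto_iff_norm_sub_tendsto_zero.1 hz
    simpa using (((pow0 hα h1).const_mul M).add ((pow0 hα h2).const_mul M)).add
      ((pow0 hβ h3).const_mul (M * (t - s) ^ α))

section Euler

variable {V W : Type*} [NormedAddCommGroup V] [NormedSpace ℝ V]
  [NormedAddCommGroup W] [NormedSpace ℝ W]

/-- The remainder of the Euler scheme is bounded by `K` times the length to the power `α (1 + β)`,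
uniformly in the mesh. -/
lemma euler_remainder_le (ι : W →L[ℝ] V) {α β T M K h : ℝ} {A : ℝ → V → W} {N : ℕ}
    (hα : 0 ≤ α) (hβ : 0 ≤ β) (hαβ : 1 ≤ α * (1 + β)) (hM : 0 ≤ M) (hK : 0 ≤ K) (hh : 0 ≤ h)
    (hN : N * h ≤ T)
    (hAbd : ∀ s t : ℝ, ∀ z : V, 0 ≤ s → s ≤ t → t ≤ T → ‖A t z - A s z‖ ≤ M * (t - s) ^ α)
    (hAhol : ∀ s t : ℝ, ∀ z w : V, 0 ≤ s → s ≤ t → t ≤ T →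
      ‖A t z - A s z - (A t w - A s w)‖ ≤ M * (t - s) ^ α * ‖z - w‖ ^ β)
    (hKle : (2 / 3 : ℝ) ^ (α * (1 + β) - 1) * K
      + M * (‖ι‖ * (M + K * T ^ (α * β))) ^ β ≤ K)
    (x₀ : V) (y : ℕ → W)
    (hy : ∀ k, y (k + 1) = y k +
      (A ((k + 1 : ℕ) * h) (x₀ + ι (y k)) - A (k * h) (x₀ + ι (y k)))) :
    ∀ n j : ℕ, j + n ≤ N →
      ‖y (j + n) - y j -
        (A ((j + n : ℕ) * h) (x₀ + ι (y j)) - A (j * h) (x₀ + ι (y j)))‖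
        ≤ K * (n * h) ^ (α * (1 + β)) := by
  have hT : 0 ≤ T := le_trans (by positivity) hN
  have grid {i : ℕ} (hi : i ≤ N) : (i : ℝ) * h ≤ T :=
    le_trans (by gcongr) hN
  intro n
  induction n using Nat.strong_induction_on with
  | _ n ih =>
    intro j hj
    obtain rfl | rfl | hn : n = 0 ∨ n = 1 ∨ 2 ≤ n := by omega
    · simp only [add_zero, sub_self, norm_zero]; positivity
    · rw [hy]
      simp only [add_sub_cancel_left, sub_self, norm_zero]; positivity
    obtain ⟨p, q, rfl, hp, hq, hpq, hqp⟩ :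
        ∃ p q, n = p + q ∧ 0 < p ∧ 0 < q ∧ p ≤ 2 * q ∧ q ≤ 2 * p :=
      ⟨n / 2, n - n / 2, by omega, by omega, by omega, by omega, by omega⟩
    have hRp := ih p (by omega) j (by omega)
    have hRq := ih q (by omega) (j + p) (by omega)
    rw [← add_assoc] at hj ⊢
    have hjp : ((j + p : ℕ) : ℝ) * h - j * h = p * h := by push_cast; ring
    have hjq : ((j + p + q : ℕ) : ℝ) * h - (j + p : ℕ) * h = q * h := by push_cast; ring
    have hle1 : (j : ℝ) * h ≤ (j + p : ℕ) * h := by gcongr; omega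
    have hle2 : ((j + p : ℕ) : ℝ) * h ≤ (j + p + q : ℕ) * h :=
      mul_le_mul_of_nonneg_right (by exact_mod_cast Nat.le_add_right _ _) hh
    have hinc : ‖y (j + p) - y j‖ ≤ (M + K * T ^ (α * β)) * (p * h) ^ α := by
      refine norm_sub_le_of_remainder hα hβ hK (by positivity) (grid (by omega)) ?_ hRp
      rw [← hjp]
      exact hAbd _ _ _ (by positivity) hle1 (grid (by omega))
    have hX : ‖(x₀ + ι (y (j + p))) - (x₀ + ι (y j))‖
        ≤ ‖ι‖ * (M + K * T ^ (α * β)) * (p * h) ^ α := by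
      rw [add_sub_add_left_eq_sub, ← map_sub, mul_assoc]
      exact (ι.le_opNorm _).trans (by gcongr)
    have hδ := hAhol ((j + p : ℕ) * h) ((j + p + q : ℕ) * h) (x₀ + ι (y (j + p)))
      (x₀ + ι (y j)) (by positivity) hle2 (grid hj)
    rw [hjq] at hδ
    set d : ℝ := ((p + q : ℕ) : ℝ) * h with hd
    have hd0 : 0 ≤ d := by positivity
    have hpd : (p : ℝ) * h ≤ d := by rw [hd]; gcongr; omega
    have hqd : (q : ℝ) * h ≤ d := by rw [hd]; gcongr; omega
    set Z := ‖ι‖ * (M + K * T ^ (α * β)) with hZ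
    have hZ0 : 0 ≤ Z := by positivity
    have hδ' : M * (q * h) ^ α * ‖(x₀ + ι (y (j + p))) - (x₀ + ι (y j))‖ ^ β
        ≤ M * Z ^ β * d ^ (α * (1 + β)) := by
      calc _ ≤ M * d ^ α * (Z * d ^ α) ^ β := by
            gcongr
            exact hX.trans (by gcongr)
        _ = _ := by
            rw [Real.mul_rpow hZ0 (by positivity), ← Real.rpow_mul hd0, mul_add, mul_one,
              Real.rpow_add_of_nonneg hd0 hα (by positivity)]
            ring
    have hsum : (p * h) ^ (α * (1 + β)) + (q * h) ^ (α * (1 + β))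
        ≤ (2 / 3 : ℝ) ^ (α * (1 + β) - 1) * d ^ (α * (1 + β)) := by
      have hde : d = p * h + q * h := by rw [hd]; push_cast; ring
      have hpq' : (p : ℝ) * h ≤ 2 * (q * h) := by
        rw [← mul_assoc]; gcongr; exact_mod_cast hpq
      have hqp' : (q : ℝ) * h ≤ 2 * (p * h) := by
        rw [← mul_assoc]; gcongr; exact_mod_cast hqp
      rw [hde]
      exact rpow_add_rpow_le_of_balanced (by positivity) (by positivity) (by norm_num) hαβ
        (by linarith) (by linarith)
    have hdθ : 0 ≤ d ^ (α * (1 + β)) := by positivity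
    have key : y (j + p + q) - y j - (A ((j + p + q : ℕ) * h) (x₀ + ι (y j)) -
        A (j * h) (x₀ + ι (y j))) =
        (y (j + p) - y j - (A ((j + p : ℕ) * h) (x₀ + ι (y j)) - A (j * h) (x₀ + ι (y j)))) +
        (y (j + p + q) - y (j + p) - (A ((j + p + q : ℕ) * h) (x₀ + ι (y (j + p))) -
          A ((j + p : ℕ) * h) (x₀ + ι (y (j + p))))) +
        (A ((j + p + q : ℕ) * h) (x₀ + ι (y (j + p))) -
          A ((j + p : ℕ) * h) (x₀ + ι (y (j + p))) -
          (A ((j + p + q : ℕ) * h) (x₀ + ι (y j)) -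
          A ((j + p : ℕ) * h) (x₀ + ι (y j)))) := by abel
    rw [key]
    refine norm_add₃_le.trans ?_
    nlinarith [mul_le_mul_of_nonneg_left hsum hK, mul_le_mul_of_nonneg_right hKle hdθ]

/-- Explicit Euler scheme with step `h`, recorded as the displacement from `x₀`. -/
def eulerScheme (ι : W →L[ℝ] V) (A : ℝ → V → W) (x₀ : V) (h : ℝ) : ℕ → W
  | 0 => 0
  | k + 1 => eulerScheme ι A x₀ h k + (A ((k + 1 : ℕ) * h) (x₀ + ι (eulerScheme ι A x₀ h k)) -
      A (k * h) (x₀ + ι (eulerScheme ι A x₀ h k)))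

end Euler


/-- **Existence of solutions to nonlinear YDEs under a compactness assumption.**
Let `W` embed continuously, injectively and compactly in `V` via `ι`, let `α(1+β) > 1` and
`A ∈ C^α_t C^β_{V,W}`.  Then for every `x₀ ∈ V` there is `x ∈ C^α([0,T];V)` with `x 0 = x₀` and
`‖x_t - x_s - A_{s,t}(x_s)‖ ≤ K (t-s)^{α(1+β)}`, i.e. a solution of
`x_t = x₀ + ∫_0^t A(ds, x_s)`. -/
theorem existence_compact_embedding
    {V W : Type*} [NormedAddCommGroup V] [NormedSpace ℝ V] [CompleteSpace V]
    [NormedAddCommGroup W] [NormedSpace ℝ W]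
    (ι : W →L[ℝ] V) (hinj : Function.Injective ι) (hcomp : IsCompactOperator (⇑ι))
    (α β : ℝ) (hα0 : 0 < α) (hα1 : α < 1) (hβ0 : 0 < β) (hβ1 : β < 1)
    (hαβ : 1 < α * (1 + β))
    (T : ℝ) (hT : 0 < T)
    (A : ℝ → V → W) (MA : ℝ)
    (hA0 : ∀ z : V, A 0 z = 0)
    (hAbd : ∀ s t : ℝ, ∀ z : V, 0 ≤ s → s ≤ t → t ≤ T →
      ‖A t z - A s z‖ ≤ MA * (t - s) ^ α)
    (hAhol : ∀ s t : ℝ, ∀ z w : V, 0 ≤ s → s ≤ t → t ≤ T →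
      ‖A t z - A s z - (A t w - A s w)‖ ≤ MA * (t - s) ^ α * ‖z - w‖ ^ β) :
    ∀ x₀ : V, ∃ (x : ℝ → V) (Kx K : ℝ),
      x 0 = x₀ ∧
      (∀ s t : ℝ, 0 ≤ s → s ≤ t → t ≤ T → ‖x t - x s‖ ≤ Kx * (t - s) ^ α) ∧
      (∀ s t : ℝ, 0 ≤ s → s ≤ t → t ≤ T →
        ‖x t - x s - ι (A t (x s) - A s (x s))‖ ≤ K * (t - s) ^ (α * (1 + β))) := by
  intro x₀
  have hMA : 0 ≤ MA := by
    have h1 := (norm_nonneg _).trans (hAbd 0 T x₀ le_rfl hT.le le_rfl)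
    rw [sub_zero] at h1
    exact nonneg_of_mul_nonneg_left h1 (by positivity)
  obtain ⟨K, hK, hKle⟩ := exists_nonneg_mul_add_rpow_le
    (Real.rpow_lt_one (by norm_num) (by norm_num) (by linarith) :
      (2 / 3 : ℝ) ^ (α * (1 + β) - 1) < 1) hβ0 hβ1 hMA (norm_nonneg ι)
    (Real.rpow_nonneg hT.le (α * β))
  set h : ℕ → ℝ := fun n => T / (n + 1) with hh
  have hpos (n : ℕ) : 0 < h n := by simp only [hh]; positivity
  have hNh (n : ℕ) : ((n + 1 : ℕ) : ℝ) * h n = T := by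
    simp only [hh]; push_cast; field_simp
  have hlim : Tendsto h atTop (𝓝 0) := by
    have := (tendsto_one_div_add_atTop_nhds_zero_nat (𝕜 := ℝ)).const_mul T
    simpa [hh, div_eq_mul_inv] using this
  set κ : ℕ → ℝ → ℕ := fun n t => ⌊t / h n⌋₊ with hκ
  have hκle {n : ℕ} {t : ℝ} (ht : 0 ≤ t) : κ n t * h n ≤ t :=
    (le_div_iff₀ (hpos n)).1 (Nat.floor_le (div_nonneg ht (hpos n).le))
  have hκgt (n : ℕ) (t : ℝ) : t - h n ≤ κ n t * h n := by
    have h1 := (div_lt_iff₀ (hpos n)).1 (Nat.lt_floor_add_one (t / h n))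
    simp only [hκ]
    linarith
  have hκN {n : ℕ} {t : ℝ} (ht : t ≤ T) : κ n t ≤ n + 1 := by
    refine Nat.floor_le_of_le ((div_le_iff₀ (hpos n)).2 ?_)
    rw [hNh]; exact ht
  have hκmono {n : ℕ} {s t : ℝ} (hst : s ≤ t) : κ n s ≤ κ n t :=
    Nat.floor_mono (div_le_div_of_nonneg_right hst (hpos n).le)
  set F : Ultrafilter ℕ := hyperfilter ℕ with hF
  have hκlim {t : ℝ} (ht : 0 ≤ t) : Tendsto (fun n => κ n t * h n) F (𝓝 t) := by
    have h1 : Tendsto (fun n => t - h n) atTop (𝓝 t) := by simpa using hlim.const_sub t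
    exact (tendsto_of_tendsto_of_tendsto_of_le_of_le h1 tendsto_const_nhds
      (fun n => hκgt n t) (fun n => hκle ht)).mono_left Nat.hyperfilter_le_atTop
  set y : ℕ → ℕ → W := fun n => eulerScheme ι A x₀ (h n) with hy
  set C : ℝ := MA + K * T ^ (α * β) with hC
  have hC0 : 0 ≤ C := by positivity
  have hR (n i j : ℕ) (hij : i ≤ j) (hj : j ≤ n + 1) :
      ‖y n j - y n i - (A (j * h n) (x₀ + ι (y n i)) - A (i * h n) (x₀ + ι (y n i)))‖
        ≤ K * (j * h n - i * h n) ^ (α * (1 + β)) := by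
    obtain ⟨m, rfl⟩ := Nat.exists_eq_add_of_le hij
    have h1 := euler_remainder_le ι hα0.le hβ0.le hαβ.le hMA hK (hpos n).le (hNh n).le
      hAbd hAhol hKle x₀ (y n) (fun k => rfl) m i hj
    have h2 : ((i + m : ℕ) : ℝ) * h n - i * h n = m * h n := by push_cast; ring
    rwa [h2]
  have hH (n i j : ℕ) (hij : i ≤ j) (hj : j ≤ n + 1) :
      ‖y n j - y n i‖ ≤ C * (j * h n - i * h n) ^ α := by
    have hi0 : (0 : ℝ) ≤ i * h n := mul_nonneg i.cast_nonneg (hpos n).le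
    have hij' : (i : ℝ) * h n ≤ j * h n :=
      mul_le_mul_of_nonneg_right (by exact_mod_cast hij) (hpos n).le
    have hjT : (j : ℝ) * h n ≤ T :=
      (mul_le_mul_of_nonneg_right (by exact_mod_cast hj) (hpos n).le).trans (hNh n).le
    exact norm_sub_le_of_remainder hα0.le hβ0.le hK (by linarith) (by linarith)
      (hAbd _ _ _ hi0 hij' hjT) (hR n i j hij hj)
  have hbd (n j : ℕ) (hj : j ≤ n + 1) : y n j ∈ Metric.closedBall (0 : W) (C * T ^ α) := by
    have h1 := hH n 0 j (Nat.zero_le _) hj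
    have h2 : (j : ℝ) * h n ≤ T :=
      (mul_le_mul_of_nonneg_right (by exact_mod_cast hj) (hpos n).le).trans (hNh n).le
    have h3 : (0 : ℝ) ≤ j * h n := mul_nonneg j.cast_nonneg (hpos n).le
    have h4 : y n 0 = 0 := rfl
    rw [h4, sub_zero, Nat.cast_zero, zero_mul, sub_zero] at h1
    rw [mem_closedBall_zero_iff]
    exact h1.trans (by gcongr)
  have hex (t : ℝ) (ht : t ≤ T) :
      ∃ v, Tendsto (fun n => x₀ + ι (y n (κ n t))) F (𝓝 v) := by
    have hcpt := hcomp.isCompact_closure_image_closedBall (C * T ^ α)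
    obtain ⟨v, -, hv⟩ := hcpt.ultrafilter_le_nhds' (F.map fun n => ι (y n (κ n t)))
      (Ultrafilter.mem_map.2 (Filter.univ_mem' fun n : ℕ =>
        subset_closure ⟨_, hbd n _ (hκN ht), rfl⟩))
    have hv' : Tendsto (fun n => ι (y n (κ n t))) F (𝓝 v) := hv
    exact ⟨x₀ + v, hv'.const_add x₀⟩
  choose! x hx using hex
  have hdiff {s t : ℝ} (hs : 0 ≤ s) (hst : s ≤ t) {γ : ℝ} (hγ : 0 < γ) :
      Tendsto (fun n => (κ n t * h n - κ n s * h n) ^ γ) F (𝓝 ((t - s) ^ γ)) :=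
    ((hκlim (hs.trans hst)).sub (hκlim hs)).rpow_const (Or.inr hγ.le)
  refine ⟨x, ‖ι‖ * C, ‖ι‖ * K, ?_, ?_, ?_⟩
  · refine tendsto_nhds_unique (hx 0 hT.le) ?_
    have h0 (n : ℕ) : y n (κ n 0) = 0 := by
      have : κ n 0 = 0 := by simp [hκ]
      rw [this]; rfl
    simp [h0]
  · intro s t hs hst htT
    refine le_of_tendsto_of_tendsto' ((hx t htT).sub (hx s (hst.trans htT))).norm
      ((hdiff hs hst hα0).const_mul (‖ι‖ * C)) fun n => ?_
    rw [add_sub_add_left_eq_sub, ← map_sub, mul_assoc]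
    exact (ι.le_opNorm _).trans (mul_le_mul_of_nonneg_left
      (hH n _ _ (hκmono hst) (hκN htT)) (norm_nonneg _))
  · intro s t hs hst htT
    have ht := hs.trans hst
    have hinc := tendsto_increment hα0 hβ0 hAbd hAhol hs hst htT
      (fun n => mul_nonneg (κ n s).cast_nonneg (hpos n).le) (fun n => hκle hs)
      (fun n => mul_nonneg (κ n t).cast_nonneg (hpos n).le) (fun n => hκle ht)
      (hκlim hs) (hκlim ht) (hx s (hst.trans htT))
    refine le_of_tendsto_of_tendsto' (((hx t htT).sub (hx s (hst.trans htT))).sub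
      ((ι.continuous.tendsto _).comp hinc)).norm
      ((hdiff hs hst (by linarith : 0 < α * (1 + β))).const_mul (‖ι‖ * K)) fun n => ?_
    rw [add_sub_add_left_eq_sub, Function.comp_apply, ← map_sub, ← map_sub, mul_assoc]
    exact (ι.le_opNorm _).trans (mul_le_mul_of_nonneg_left
      (hR n _ _ (hκmono hst) (hκN htT)) (norm_nonneg _))
end

section
/- A priori estimate for solutions: Let α ∈ (1/2,1), β ∈ (0,1) with α(1+β) > 1, A ∈ C^α_t C^β_V, x₀ ∈ V and κ ≥ 0. Let x ∈ C^α([0,T];V) satisfy x(0) = x₀ and ‖x_t − x_s − A_{s,t}(x_s)‖_V ≤ κ ⟦A⟧_{α,β} ⟦x⟧_{α;[s,t]}^β (t−s)^{α(1+β)} for all 0 ≤ s ≤ t ≤ T (as does, by the sewing lemma, every solution of the YDE x_t = x₀ + ∫_0^t A(ds,x_s), with κ depending only on α(1+β)). Then there exists C = C(α,β,T,κ) such that ⟦x⟧_α ≤ C (1 + ‖A‖_{α,β}²) and ‖x‖_α ≤ C (1 + ‖x₀‖_V + ‖A‖_{α,β}²). -/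
/-- The `γ`-Hölder seminorm of a path on a subinterval `[a,b]`. -/
noncomputable def holderSemiBetween {V : Type*} [NormedAddCommGroup V]
    (γ a b : ℝ) (x : ℝ → V) : ℝ :=
  sSup {r : ℝ | ∃ s t : ℝ, a ≤ s ∧ s < t ∧ t ≤ b ∧ r = ‖x t - x s‖ / (t - s) ^ γ}

theorem bddAbove_holderQuotients {V : Type*} [NormedAddCommGroup V] {γ a b K : ℝ} {x : ℝ → V}
    (hx : ∀ s t : ℝ, a ≤ s → s < t → t ≤ b → ‖x t - x s‖ ≤ K * (t - s) ^ γ) :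
    BddAbove {r : ℝ | ∃ s t : ℝ, a ≤ s ∧ s < t ∧ t ≤ b ∧ r = ‖x t - x s‖ / (t - s) ^ γ} := by
  refine ⟨K, ?_⟩
  rintro r ⟨s, t, has, hst, htb, rfl⟩
  exact (div_le_iff₀ (Real.rpow_pos_of_pos (sub_pos.2 hst) γ)).2 (hx s t has hst htb)

theorem holderSemiBetween_nonneg {V : Type*} [NormedAddCommGroup V] (γ a b : ℝ) (x : ℝ → V) :
    0 ≤ holderSemiBetween γ a b x := by
  refine Real.sSup_nonneg ?_
  rintro r ⟨s, t, -, hst, -, rfl⟩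
  exact div_nonneg (norm_nonneg _) (Real.rpow_nonneg (sub_pos.2 hst).le γ)

theorem holderSemiBetween_mono {V : Type*} [NormedAddCommGroup V] {γ a b K s t : ℝ} {x : ℝ → V}
    (hx : ∀ s t : ℝ, a ≤ s → s < t → t ≤ b → ‖x t - x s‖ ≤ K * (t - s) ^ γ)
    (has : a ≤ s) (hst : s < t) (htb : t ≤ b) :
    holderSemiBetween γ s t x ≤ holderSemiBetween γ a b x := by
  refine csSup_le_csSup (bddAbove_holderQuotients hx) ⟨_, s, t, le_rfl, hst, le_rfl, rfl⟩ ?_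
  rintro r ⟨u, v, hsu, huv, hvt, rfl⟩
  exact ⟨u, v, has.trans hsu, huv, hvt.trans htb, rfl⟩

/-- If the sublinear feedback of the Hölder seminorm carries a factor at most `1/2` on `[a,b]`, it
can be absorbed into the left-hand side. -/
theorem norm_sub_le_of_feedback {V : Type*} [NormedAddCommGroup V] {γ δ β a b K M L : ℝ}
    {x : ℝ → V} (hδ : 0 ≤ δ) (hβ0 : 0 ≤ β) (hβ1 : β ≤ 1) (hL : 0 ≤ L) (hab : a < b)
    (hx : ∀ s t : ℝ, a ≤ s → s < t → t ≤ b → ‖x t - x s‖ ≤ K * (t - s) ^ γ)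
    (hfb : ∀ s t : ℝ, a ≤ s → s < t → t ≤ b →
      ‖x t - x s‖ ≤ (M + L * holderSemiBetween γ s t x ^ β * (t - s) ^ δ) * (t - s) ^ γ)
    (hsmall : L * (b - a) ^ δ ≤ 1 / 2) :
    ‖x b - x a‖ ≤ (2 * M + 1) * (b - a) ^ γ := by
  set H := holderSemiBetween γ a b x with hH
  have hH0 : 0 ≤ H := holderSemiBetween_nonneg γ a b x
  have hpow : H ^ β ≤ 1 + H := by
    rcases le_total H 1 with h | h
    · linarith [Real.rpow_le_one hH0 h hβ0]
    · linarith [Real.rpow_le_self_of_one_le h hβ1]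
  have hself : H ≤ M + 1 / 2 * (1 + H) := by
    refine csSup_le ⟨_, a, b, le_rfl, hab, le_rfl, rfl⟩ ?_
    rintro r ⟨s, t, has, hst, htb, rfl⟩
    have hts : 0 < t - s := sub_pos.2 hst
    refine (div_le_iff₀ (Real.rpow_pos_of_pos hts γ)).2 ((hfb s t has hst htb).trans ?_)
    refine mul_le_mul_of_nonneg_right ?_ (Real.rpow_nonneg hts.le γ)
    gcongr M + ?_
    calc L * holderSemiBetween γ s t x ^ β * (t - s) ^ δ
        ≤ L * H ^ β * (b - a) ^ δ := by
          have := holderSemiBetween_nonneg γ s t x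
          gcongr
          exact holderSemiBetween_mono hx has hst htb
      _ = L * (b - a) ^ δ * H ^ β := by ring
      _ ≤ 1 / 2 * (1 + H) := by gcongr
  have hba : 0 < (b - a) ^ γ := Real.rpow_pos_of_pos (sub_pos.2 hab) γ
  calc ‖x b - x a‖ ≤ H * (b - a) ^ γ := (div_le_iff₀ hba).1
        (le_csSup (bddAbove_holderQuotients hx) ⟨a, b, le_rfl, hab, le_rfl, rfl⟩)
    _ ≤ (2 * M + 1) * (b - a) ^ γ := by gcongr; linarith

/-- Summing a Hölder bound over `N` equal subintervals costs a factor `N ^ (1 - γ)`. -/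
theorem norm_sub_le_of_subdivision {V : Type*} [NormedAddCommGroup V] {γ s t B : ℝ} {x : ℝ → V}
    {N : ℕ} (hN : 0 < N) (hst : s ≤ t)
    (hx : ∀ u : ℝ, s ≤ u → u + (t - s) / N ≤ t →
      ‖x (u + (t - s) / N) - x u‖ ≤ B * ((t - s) / N) ^ γ) :
    ‖x t - x s‖ ≤ (N : ℝ) ^ (1 - γ) * B * (t - s) ^ γ := by
  have hN' : (0 : ℝ) < N := Nat.cast_pos.2 hN
  have hts : 0 ≤ t - s := sub_nonneg.2 hst
  set h := (t - s) / N with hh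
  have hNh : N * h = t - s := by rw [hh]; field_simp
  have h0 : 0 ≤ h := by positivity
  have hstep : ∀ k, k < N → dist (x (s + k * h)) (x (s + (k + 1 : ℕ) * h)) ≤ B * h ^ γ := by
    intro k hk
    have hk' : ((k : ℝ) + 1) * h ≤ N * h := by
      gcongr
      exact_mod_cast hk
    have hu := hx (s + k * h) (by nlinarith [mul_nonneg k.cast_nonneg h0]) (by linarith)
    have hnext : s + ((k + 1 : ℕ) : ℝ) * h = s + k * h + h := by push_cast; ring
    rwa [dist_comm, dist_eq_norm, hnext]
  have hsum := dist_le_range_sum_of_dist_le (f := fun k : ℕ => x (s + k * h)) N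
    (d := fun _ => B * h ^ γ) (fun {k} hk => hstep k hk)
  simp only [Nat.cast_zero, zero_mul, add_zero, hNh, add_sub_cancel, Finset.sum_const,
    Finset.card_range, nsmul_eq_mul] at hsum
  rw [dist_comm, dist_eq_norm] at hsum
  refine hsum.trans_eq ?_
  rw [hh, Real.div_rpow hts hN'.le, Real.rpow_sub hN', Real.rpow_one]
  ring

/-- A number of subintervals large enough for `c ≤ N ^ δ`, with `N ^ δ` of order `c`. -/
theorem exists_nat_le_rpow_le {δ c : ℝ} (hδ0 : 0 < δ) (hδ1 : δ ≤ 1) (hc : 0 ≤ c) :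
    ∃ N : ℕ, 0 < N ∧ c ≤ (N : ℝ) ^ δ ∧ (N : ℝ) ^ δ ≤ c + 2 := by
  have hroot : (c ^ (1 / δ)) ^ δ = c := by
    rw [← Real.rpow_mul hc, one_div_mul_cancel hδ0.ne', Real.rpow_one]
  have hr : 0 ≤ c ^ (1 / δ) := Real.rpow_nonneg hc _
  refine ⟨⌈c ^ (1 / δ)⌉₊ + 1, Nat.succ_pos _, ?_, ?_⟩
  · calc c = (c ^ (1 / δ)) ^ δ := hroot.symm
      _ ≤ _ := by
        gcongr
        push_cast
        linarith [Nat.le_ceil (c ^ (1 / δ))]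
  · calc ((⌈c ^ (1 / δ)⌉₊ + 1 : ℕ) : ℝ) ^ δ ≤ (c ^ (1 / δ) + 2) ^ δ := by
          gcongr
          push_cast
          linarith [Nat.ceil_lt_add_one hr]
      _ ≤ (c ^ (1 / δ)) ^ δ + 2 ^ δ := Real.rpow_add_le_add_rpow hr zero_le_two hδ0.le hδ1
      _ ≤ c + 2 := by
        rw [hroot]
        gcongr
        exact Real.rpow_le_self_of_one_le one_le_two hδ1

/-- **A priori estimate for solutions of nonlinear YDEs.**  Let `α ∈ (1/2,1)`, `β ∈ (0,1)`
with `α(1+β) > 1`, `A ∈ C^α_t C^β_V` and let `x ∈ C^α([0,T];V)` with `x 0 = x₀` satisfy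
`‖x_t - x_s - A_{s,t}(x_s)‖ ≤ κ ⟦A⟧_{α,β} ⟦x⟧_{α;[s,t]}^β (t-s)^{α(1+β)}`.  Then there is
`C = C(α,β,T,κ)` with `⟦x⟧_α ≤ C (1 + ‖A‖_{α,β}²)` and
`‖x‖_α ≤ C (1 + ‖x₀‖ + ‖A‖_{α,β}²)`. -/
theorem apriori_estimate
    {V : Type*} [NormedAddCommGroup V] [NormedSpace ℝ V]
    (α β : ℝ) (hα0 : 1/2 < α) (hα1 : α < 1) (hβ0 : 0 < β) (hβ1 : β < 1)
    (hαβ : 1 < α * (1 + β)) (T : ℝ) (hT : 0 < T) (κ : ℝ) (hκ : 0 ≤ κ) :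
    ∃ C : ℝ, 0 ≤ C ∧
      ∀ (A : ℝ → V → V) (MA : ℝ) (x₀ : V) (x : ℝ → V) (Kx : ℝ),
        (∀ z : V, A 0 z = 0) →
        (∀ s t : ℝ, ∀ z : V, 0 ≤ s → s ≤ t → t ≤ T →
          ‖A t z - A s z‖ ≤ MA * (t - s) ^ α) →
        (∀ s t : ℝ, ∀ z w : V, 0 ≤ s → s ≤ t → t ≤ T →
          ‖A t z - A s z - (A t w - A s w)‖ ≤ MA * (t - s) ^ α * ‖z - w‖ ^ β) →
        x 0 = x₀ →
        (∀ s t : ℝ, 0 ≤ s → s ≤ t → t ≤ T → ‖x t - x s‖ ≤ Kx * (t - s) ^ α) →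
        (∀ s t : ℝ, 0 ≤ s → s ≤ t → t ≤ T →
          ‖x t - x s - (A t (x s) - A s (x s))‖ ≤
            κ * MA * holderSemiBetween α s t x ^ β * (t - s) ^ (α * (1 + β))) →
        (∀ s t : ℝ, 0 ≤ s → s ≤ t → t ≤ T →
          ‖x t - x s‖ ≤ C * (1 + MA ^ 2) * (t - s) ^ α) ∧
        (∀ t : ℝ, 0 ≤ t → t ≤ T → ‖x t‖ ≤ C * (1 + ‖x₀‖ + MA ^ 2)) ∧
        (∀ s t : ℝ, 0 ≤ s → s ≤ t → t ≤ T →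
          ‖x t - x s‖ ≤ C * (1 + ‖x₀‖ + MA ^ 2) * (t - s) ^ α) := by
  have hδ0 : 0 < α * β := by nlinarith
  have hδ1 : α * β ≤ 1 := by nlinarith
  set u := 2 * κ * T ^ (α * β) with hu
  have hu0 : 0 ≤ u := by positivity
  have hTα : 0 ≤ T ^ α := by positivity
  set D := 3 * u + 6 with hD
  have hD0 : 0 ≤ D := by positivity
  refine ⟨1 + D + D * T ^ α, by positivity, ?_⟩
  intro A M x₀ x K _ hA _ hx0 hxK hxA
  have hM : 0 ≤ M := by
    have h := (norm_nonneg _).trans (hA 0 T x₀ le_rfl hT.le le_rfl)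
    rw [sub_zero] at h
    exact nonneg_of_mul_nonneg_left h (Real.rpow_pos_of_pos hT α)
  obtain ⟨N, hN, hNlow, hNup⟩ := exists_nat_le_rpow_le hδ0 hδ1 (mul_nonneg hu0 hM)
  have hN1 : (1 : ℝ) ≤ N := by exact_mod_cast hN
  have hfactor : (N : ℝ) ^ (1 - α) * (2 * M + 1) ≤ D * (1 + M ^ 2) := by
    calc (N : ℝ) ^ (1 - α) * (2 * M + 1) ≤ (u * M + 2) * (2 * M + 1) := by
          gcongr
          exact (Real.rpow_le_rpow_of_exponent_le hN1 (by linarith)).trans hNup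
      _ ≤ D * (1 + M ^ 2) := by
          have hMM : M ≤ 1 + M ^ 2 := by nlinarith [sq_nonneg (M - 1)]
          nlinarith [mul_le_mul_of_nonneg_left hMM hu0, mul_nonneg hu0 (sq_nonneg M)]
  have hshort : ∀ a b : ℝ, 0 ≤ a → a < b → b ≤ T → b - a ≤ T / N →
      ‖x b - x a‖ ≤ (2 * M + 1) * (b - a) ^ α := by
    intro a b ha hab hb hlen
    refine norm_sub_le_of_feedback (K := K) (L := κ * M) hδ0.le hβ0.le hβ1.le
      (mul_nonneg hκ hM) hab
      (fun s t hs hst ht => hxK s t (ha.trans hs) hst.le (ht.trans hb)) ?_ ?_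
    · intro s t hs hst ht
      have h1 := hA s t (x s) (ha.trans hs) hst.le (ht.trans hb)
      have h2 := hxA s t (ha.trans hs) hst.le (ht.trans hb)
      have h3 := norm_add_le (x t - x s - (A t (x s) - A s (x s))) (A t (x s) - A s (x s))
      rw [sub_add_cancel] at h3
      rw [mul_add, mul_one, Real.rpow_add (sub_pos.2 hst)] at h2
      linarith
    · have hNδ : 0 < (N : ℝ) ^ (α * β) := by positivity
      calc κ * M * (b - a) ^ (α * β) ≤ κ * M * (T / N) ^ (α * β) := by
            have := sub_nonneg.2 hab.le
            gcongr
        _ = u * M / (N : ℝ) ^ (α * β) / 2 := by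
            rw [Real.div_rpow hT.le N.cast_nonneg, hu]
            ring
        _ ≤ 1 / 2 := by
            gcongr
            exact (div_le_one hNδ).2 hNlow
  have hsemi : ∀ s t : ℝ, 0 ≤ s → s ≤ t → t ≤ T →
      ‖x t - x s‖ ≤ D * (1 + M ^ 2) * (t - s) ^ α := by
    intro s t hs hst ht
    have hts : 0 ≤ t - s := sub_nonneg.2 hst
    rcases hst.eq_or_lt with rfl | hlt
    · simp only [sub_self, norm_zero] at hts ⊢
      positivity
    refine (norm_sub_le_of_subdivision (B := 2 * M + 1) hN hst ?_).trans (by gcongr)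
    intro v hv hvt
    have hpos : 0 < (t - s) / N := div_pos (sub_pos.2 hlt) (by linarith)
    have hlen : (t - s) / N ≤ T / N := by gcongr; linarith
    have h := hshort v (v + (t - s) / N) (hs.trans hv) (by linarith) (hvt.trans ht)
      (by linarith)
    rwa [add_sub_cancel_left] at h
  have hDC : D ≤ 1 + D + D * T ^ α := by nlinarith [mul_nonneg hD0 hTα]
  refine ⟨fun s t hs hst ht => (hsemi s t hs hst ht).trans ?_, fun t ht htT => ?_,
    fun s t hs hst ht => (hsemi s t hs hst ht).trans ?_⟩
  · have := sub_nonneg.2 hst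
    gcongr
  · have h := hsemi 0 t le_rfl ht htT
    rw [sub_zero, hx0] at h
    have htα : t ^ α ≤ T ^ α := by gcongr
    have hbound : D * (1 + M ^ 2) * t ^ α ≤ D * (1 + M ^ 2) * T ^ α := by gcongr
    have htri := norm_sub_norm_le (x t) x₀
    have hDT := mul_nonneg hD0 hTα
    nlinarith [mul_nonneg hD0 (norm_nonneg x₀), mul_nonneg hDT (norm_nonneg x₀),
      mul_nonneg hD0 (sq_nonneg M), sq_nonneg M]
  · have := sub_nonneg.2 hst
    gcongr
    linarith [norm_nonneg x₀]
end

section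
/- Invariants of Young differential equations: Let α, β ∈ (0,1) with α(1+β) > 1, A ∈ C^α_t C^β_V, and let x ∈ C^α([0,T];V) be a solution of the YDE x_t = x_0 + ∫_0^t A(ds,x_s), i.e. there is K ≥ 0 with ‖x_t − x_s − A_{s,t}(x_s)‖_V ≤ K(t−s)^{α(1+β)} for all s ≤ t. Assume F : V → ℝ is twice continuously Fréchet differentiable and satisfies DF(z)(A_{s,t}(z)) = 0 for every z ∈ V and all 0 ≤ s ≤ t ≤ T. Then F(x_t) = F(x_0) for every t ∈ [0,T]. -/
open Filter Topology Asymptotics Set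

/-- First-order Taylor expansion of a `C²` map with quadratic remainder. -/
theorem ContDiff.isBigO_taylor_one {V W : Type*} [NormedAddCommGroup V] [NormedSpace ℝ V]
    [NormedAddCommGroup W] [NormedSpace ℝ W] {F : V → W} (hF : ContDiff ℝ 2 F) (z : V) :
    (fun y => F y - F z - fderiv ℝ F z (y - z)) =O[𝓝 z] fun y => ‖y - z‖ ^ 2 := by
  have hd : Differentiable ℝ F := hF.differentiable (by norm_num)
  have hdd : Differentiable ℝ (fderiv ℝ F) :=
    (hF.fderiv_right (m := 1) (by norm_num)).differentiable (by norm_num)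
  obtain ⟨C, hC0, hC⟩ := (hdd z).isBigO_sub.exists_nonneg
  obtain ⟨r, hr, hball⟩ := Metric.eventually_nhds_iff.1 hC.bound
  refine IsBigO.of_bound C (Metric.eventually_nhds_iff.2 ⟨r, hr, fun y hy => ?_⟩)
  have hbound : ∀ w ∈ Metric.closedBall z ‖y - z‖,
      ‖fderiv ℝ F w - fderiv ℝ F z‖ ≤ C * ‖y - z‖ := by
    intro w hw
    rw [Metric.mem_closedBall] at hw
    rw [dist_eq_norm] at hy
    refine (hball (hw.trans_lt hy)).trans ?_
    rw [dist_eq_norm] at hw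
    gcongr
  have h := (convex_closedBall z ‖y - z‖).norm_image_sub_le_of_norm_hasFDerivWithin_le'
    (fun w _ => (hd w).hasFDerivAt.hasFDerivWithinAt) hbound
    (Metric.mem_closedBall_self (norm_nonneg _)) (by simp [dist_eq_norm] : y ∈ _)
  rw [norm_pow, norm_norm, pow_two, ← mul_assoc]
  exact h

/-- A power with exponent larger than one is negligible with respect to the increment. -/
theorem isLittleO_sub_rpow {γ : ℝ} (hγ : 1 < γ) (s : ℝ) :
    (fun t : ℝ => (t - s) ^ γ) =o[𝓝[≥] s] fun t => t - s := by
  have h0 : Tendsto (fun t : ℝ => (t - s) ^ (γ - 1)) (𝓝[≥] s) (𝓝 0) := by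
    have : ContinuousAt (fun t : ℝ => (t - s) ^ (γ - 1)) s :=
      (continuousAt_id.sub continuousAt_const).rpow_const (Or.inr (by linarith))
    have h := this.tendsto
    rw [sub_self, Real.zero_rpow (by linarith)] at h
    exact h.mono_left nhdsWithin_le_nhds
  have h := ((isLittleO_one_iff ℝ).2 h0).mul_isBigO (isBigO_refl (fun t : ℝ => t - s) (𝓝[≥] s))
  simp only [one_mul] at h
  refine h.congr' ?_ EventuallyEq.rfl
  filter_upwards [self_mem_nhdsWithin] with t ht
  rw [← Real.rpow_add_one' (sub_nonneg.2 ht) (by linarith), sub_add_cancel]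

/-- **Invariants of Young differential equations.**  Let `α(1+β) > 1`, `A ∈ C^α_t C^β_V`, and
let `x ∈ C^α([0,T];V)` be a solution of the YDE `x_t = x_0 + ∫_0^t A(ds,x_s)`.  If
`F : V → ℝ` is `C²` and `DF(z)(A_{s,t}(z)) = 0` for all `z` and `s ≤ t`, then `F` is constant
along `x`. -/
theorem yde_invariant
    {V : Type*} [NormedAddCommGroup V] [NormedSpace ℝ V]
    (α β : ℝ) (hα0 : 0 < α) (hα1 : α < 1) (hβ0 : 0 < β) (hβ1 : β < 1)
    (hαβ : 1 < α * (1 + β)) (T : ℝ) (hT : 0 < T)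
    (A : ℝ → V → V) (MA : ℝ)
    (hA0 : ∀ z : V, A 0 z = 0)
    (hAbd : ∀ s t : ℝ, ∀ z : V, 0 ≤ s → s ≤ t → t ≤ T →
      ‖A t z - A s z‖ ≤ MA * (t - s) ^ α)
    (hAhol : ∀ s t : ℝ, ∀ z w : V, 0 ≤ s → s ≤ t → t ≤ T →
      ‖A t z - A s z - (A t w - A s w)‖ ≤ MA * (t - s) ^ α * ‖z - w‖ ^ β)
    (x : ℝ → V) (Kx K : ℝ)
    (hx : ∀ s t : ℝ, 0 ≤ s → s ≤ t → t ≤ T → ‖x t - x s‖ ≤ Kx * (t - s) ^ α)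
    (hsol : ∀ s t : ℝ, 0 ≤ s → s ≤ t → t ≤ T →
      ‖x t - x s - (A t (x s) - A s (x s))‖ ≤ K * (t - s) ^ (α * (1 + β)))
    (F : V → ℝ) (hF : ContDiff ℝ 2 F)
    (hinv : ∀ z : V, ∀ s t : ℝ, 0 ≤ s → s ≤ t → t ≤ T →
      fderiv ℝ F z (A t z - A s z) = 0) :
    ∀ t : ℝ, 0 ≤ t → t ≤ T → F (x t) = F (x 0) := by
  have hcx : ContinuousOn x (Icc 0 T) := by
    intro s hs
    rw [ContinuousWithinAt, tendsto_iff_norm_sub_tendsto_zero]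
    have hlim : Tendsto (fun t : ℝ => Kx * |t - s| ^ α) (𝓝[Icc 0 T] s) (𝓝 0) := by
      have hc : ContinuousAt (fun t : ℝ => Kx * |t - s| ^ α) s :=
        continuousAt_const.mul
          ((continuousAt_id.sub continuousAt_const).abs.rpow_const (Or.inr hα0.le))
      have h := hc.tendsto
      rw [sub_self, abs_zero, Real.zero_rpow hα0.ne', mul_zero] at h
      exact h.mono_left nhdsWithin_le_nhds
    refine squeeze_zero' (Eventually.of_forall fun _ => norm_nonneg _) ?_ hlim
    filter_upwards [self_mem_nhdsWithin] with t ht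
    rcases le_total s t with hst | hts
    · rw [abs_of_nonneg (sub_nonneg.2 hst)]
      exact hx s t hs.1 hst ht.2
    · rw [abs_sub_comm, abs_of_nonneg (sub_nonneg.2 hts), norm_sub_rev]
      exact hx t s ht.1 hts hs.2
  have hderiv : ∀ s ∈ Ico 0 T, HasDerivWithinAt (F ∘ x) 0 (Ici s) s := by
    intro s hs
    have hmem : ∀ᶠ t in 𝓝[≥] s, s ≤ t ∧ t ≤ T :=
      (Icc_mem_nhdsGE hs.2 : Icc s T ∈ 𝓝[≥] s)
    have hle : 𝓝[≥] s ≤ 𝓝[Icc 0 T] s :=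
      le_inf inf_le_left (le_principal_iff.2 (hmem.mono fun t ht => ⟨hs.1.trans ht.1, ht.2⟩))
    have hxs : Tendsto x (𝓝[≥] s) (𝓝 (x s)) := (hcx s ⟨hs.1, hs.2.le⟩).mono_left hle
    have hxO : (fun t => ‖x t - x s‖ ^ 2) =O[𝓝[≥] s] fun t => (t - s) ^ (2 * α) := by
      refine IsBigO.of_bound (Kx ^ 2) (hmem.mono fun t ht => ?_)
      have hts : 0 ≤ t - s := sub_nonneg.2 ht.1
      rw [norm_pow, norm_norm, Real.norm_of_nonneg (Real.rpow_nonneg hts _), mul_comm 2 α,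
        Real.rpow_mul hts, Real.rpow_two, ← mul_pow]
      exact pow_le_pow_left₀ (norm_nonneg _) (hx s t hs.1 ht.1 ht.2) 2
    have hquad := (((hF.isBigO_taylor_one (x s)).comp_tendsto hxs).trans hxO).trans_isLittleO
      (isLittleO_sub_rpow (by nlinarith) s)
    have hlin : (fun t => fderiv ℝ F (x s) (x t - x s)) =o[𝓝[≥] s] fun t => t - s := by
      have hO : (fun t => x t - x s - (A t (x s) - A s (x s))) =O[𝓝[≥] s]
          fun t => (t - s) ^ (α * (1 + β)) := by
        refine IsBigO.of_bound K (hmem.mono fun t ht => ?_)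
        rw [Real.norm_of_nonneg (Real.rpow_nonneg (sub_nonneg.2 ht.1) _)]
        exact hsol s t hs.1 ht.1 ht.2
      refine ((((fderiv ℝ F (x s)).isBigO_comp _ _).trans hO).trans_isLittleO
        (isLittleO_sub_rpow hαβ s)).congr' (hmem.mono fun t ht => ?_) EventuallyEq.rfl
      simp only [map_sub _ (x t - x s), hinv (x s) s t hs.1 ht.1 ht.2, sub_zero]
    rw [hasDerivWithinAt_iff_isLittleO]
    refine (hquad.add hlin).congr_left fun t => ?_
    simp
  intro t ht0 htT
  exact constant_of_has_deriv_right_zero (hF.continuous.comp_continuousOn hcx) hderiv t ⟨ht0, htT⟩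
end
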